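/- For fixed x > 0, as ν → ∞, ∫_x^∞ J_ν(t) Y_ν(t)/t dt = (1/(νπ)) ln(x/(2ν)) + O(1/ν³). -/

import Mathlib

open MeasureTheory Real Filter Set Topology

noncomputable def besselJ (ν x : ℝ) : ℝ :=
  (x / 2) ^ ν * ∑' k : ℕ, (-1 : ℝ) ^ k * (x ^ 2 / 4) ^ k / (k.factorial * Real.Gamma (ν + k + 1))

noncomputable def besselY (ν x : ℝ) : ℝ :=
  limUnder (𝓝[{μ : ℝ | ∀ n : ℤ, μ ≠ (n : ℝ)}] ν)
    (fun μ => (besselJ μ x * Real.cos (μ * Real.pi) - besselJ (-μ) x) / Real.sin (μ * Real.pi))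

/-- The entire function `∑ (-z)^k / (k! Γ(μ + k + 1))` of `μ` and `z`. -/
noncomputable def besselSeries (μ z : ℂ) : ℂ :=
  ∑' k : ℕ, (-z) ^ k / k.factorial * (Complex.Gamma (μ + k + 1))⁻¹

theorem exists_norm_inv_Gamma_add_nat_le (R : ℝ) :
    ∃ M : ℝ, 0 ≤ M ∧ ∀ μ : ℂ, ‖μ‖ ≤ R → ∀ k : ℕ, ‖(Complex.Gamma (μ + k + 1))⁻¹‖ ≤ M := by
  have hb : ∀ k : ℕ, ∃ M : ℝ, ∀ μ ∈ Metric.closedBall (0 : ℂ) R,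
      ‖(Complex.Gamma (μ + k + 1))⁻¹‖ ≤ M := by
    intro k
    refine (isCompact_closedBall (0 : ℂ) R).exists_bound_of_continuousOn ?_
    have := Complex.differentiable_one_div_Gamma.continuous
    exact (this.comp (by fun_prop : Continuous fun μ : ℂ => μ + k + 1)).continuousOn
  choose M hM using hb
  obtain ⟨N, hN⟩ := exists_nat_ge R
  refine ⟨∑ k ∈ Finset.range (N + 1), |M k|, by positivity, fun μ hμ k => ?_⟩
  have hμ' : μ ∈ Metric.closedBall (0 : ℂ) R := by simpa using hμ
  have small : ∀ k ≤ N, ‖(Complex.Gamma (μ + k + 1))⁻¹‖ ≤ ∑ k ∈ Finset.range (N + 1), |M k| := by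
    intro k hk
    refine (hM k μ hμ').trans ((le_abs_self _).trans ?_)
    exact Finset.single_le_sum (f := fun k => |M k|) (fun _ _ => abs_nonneg _)
      (Finset.mem_range.2 (by omega))
  rcases le_total k N with h | h
  · exact small k h
  · induction k, h using Nat.le_induction with
    | base => exact small N le_rfl
    | succ k hk ih =>
      refine le_trans ?_ ih
      rw [Complex.one_div_Gamma_eq_self_mul_one_div_Gamma_add_one (μ + k + 1), norm_mul]
      push_cast
      have h1 : 1 ≤ ‖μ + k + 1‖ := by
        have h2 : ‖((k + 1 : ℕ) : ℂ)‖ - ‖-μ‖ ≤ ‖((k + 1 : ℕ) : ℂ) - -μ‖ := norm_sub_norm_le _ _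
        rw [Complex.norm_natCast, norm_neg] at h2
        have h3 : ((k + 1 : ℕ) : ℂ) - -μ = μ + k + 1 := by push_cast; ring
        rw [h3] at h2
        push_cast at h2
        have : (N : ℝ) ≤ k := by exact_mod_cast hk
        linarith
      rw [show μ + (↑k + 1) + 1 = μ + k + 1 + 1 by ring]
      exact le_mul_of_one_le_left (norm_nonneg _) h1

theorem norm_besselSeries_term_le {M : ℝ} {μ : ℂ}
    (hM : ∀ k : ℕ, ‖(Complex.Gamma (μ + k + 1))⁻¹‖ ≤ M) {z : ℂ} {r : ℝ} (hz : ‖z‖ ≤ r) (k : ℕ) :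
    ‖(-z) ^ k / k.factorial * (Complex.Gamma (μ + k + 1))⁻¹‖ ≤ r ^ k / k.factorial * M := by
  rw [norm_mul, norm_div, norm_pow, norm_neg, Complex.norm_natCast]
  have := hM k
  have h0 : 0 ≤ r := (norm_nonneg _).trans hz
  gcongr

theorem summable_besselSeries (μ z : ℂ) :
    Summable fun k : ℕ => (-z) ^ k / k.factorial * (Complex.Gamma (μ + k + 1))⁻¹ := by
  obtain ⟨M, -, hM⟩ := exists_norm_inv_Gamma_add_nat_le ‖μ‖
  exact Summable.of_norm_bounded ((Real.summable_pow_div_factorial ‖z‖).mul_right M)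
    (norm_besselSeries_term_le (hM μ le_rfl) le_rfl)

theorem hasSum_besselSeries (μ z : ℂ) :
    HasSum (fun k : ℕ => (-z) ^ k / k.factorial * (Complex.Gamma (μ + k + 1))⁻¹)
      (besselSeries μ z) :=
  (summable_besselSeries μ z).hasSum

theorem differentiable_besselSeries (z : ℂ) : Differentiable ℂ fun μ => besselSeries μ z := by
  intro μ
  obtain ⟨M, -, hM⟩ := exists_norm_inv_Gamma_add_nat_le (‖μ‖ + 1)
  have h : DifferentiableOn ℂ (fun w => besselSeries w z) (Metric.ball μ 1) := by
    refine Complex.differentiableOn_tsum_of_summable_norm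
      ((Real.summable_pow_div_factorial ‖z‖).mul_right M) (fun k => ?_) Metric.isOpen_ball ?_
    · have : Differentiable ℂ fun w : ℂ => (Complex.Gamma (w + k + 1))⁻¹ :=
        Complex.differentiable_one_div_Gamma.comp
          (by fun_prop : Differentiable ℂ fun w : ℂ => w + k + 1)
      exact (this.const_mul _).differentiableOn
    · intro k w hw
      refine norm_besselSeries_term_le (hM w ?_) le_rfl k
      have h1 : ‖w - μ‖ < 1 := by simpa [dist_eq_norm] using hw
      have h2 := norm_le_norm_add_norm_sub' w μ
      linarith
  exact h.differentiableAt (Metric.isOpen_ball.mem_nhds (by simp))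

theorem besselSeries_shift (μ z : ℂ) :
    HasSum (fun k : ℕ => (k : ℂ) * ((-z) ^ k / k.factorial * (Complex.Gamma (μ + k + 1))⁻¹))
      (-z * besselSeries (μ + 1) z) := by
  rw [← hasSum_nat_add_iff' 1]
  simp only [Finset.range_one, Finset.sum_singleton, Nat.cast_zero, zero_mul, sub_zero]
  refine ((hasSum_besselSeries (μ + 1) z).mul_left (-z)).congr_fun fun k => ?_
  rw [Nat.factorial_succ]
  push_cast
  rw [show μ + (↑k + 1) + 1 = μ + 1 + k + 1 by ring]
  field_simp
  ring

theorem besselSeries_recurrence (μ z : ℂ) :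
    besselSeries μ z = (μ + 1) * besselSeries (μ + 1) z - z * besselSeries (μ + 2) z := by
  have h := ((hasSum_besselSeries (μ + 1) z).mul_left (μ + 1)).add (besselSeries_shift (μ + 1) z)
  rw [show μ + 1 + 1 = μ + 2 by ring, neg_mul, ← sub_eq_add_neg] at h
  refine (hasSum_besselSeries μ z).unique (h.congr_fun fun k => ?_)
  rw [Complex.one_div_Gamma_eq_self_mul_one_div_Gamma_add_one (μ + k + 1),
    show μ + 1 + k + 1 = μ + k + 1 + 1 by ring]
  ring

theorem hasDerivAt_besselSeries (μ z : ℂ) :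
    HasDerivAt (besselSeries μ) (-besselSeries (μ + 1) z) z := by
  obtain ⟨M, hM0, hM⟩ := exists_norm_inv_Gamma_add_nat_le ‖μ‖
  set r := ‖z‖ + 1 with hr
  have hsum : Summable fun k : ℕ => r ^ k / k.factorial * M :=
    (Real.summable_pow_div_factorial r).mul_right M
  have hd : DifferentiableOn ℂ (besselSeries μ) (Metric.ball 0 r) := by
    refine Complex.differentiableOn_tsum_of_summable_norm hsum (fun k => ?_) Metric.isOpen_ball ?_
    · fun_prop
    · intro k w hw
      exact norm_besselSeries_term_le (hM μ le_rfl) (by simpa using (mem_ball_zero_iff.1 hw).le) k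
  have hz : z ∈ Metric.ball (0 : ℂ) r := by simp [hr]
  have hs := Complex.hasSum_deriv_of_summable_norm hsum
    (F := fun (k : ℕ) z => (-z) ^ k / k.factorial * (Complex.Gamma (μ + k + 1))⁻¹)
    (fun k => by fun_prop) Metric.isOpen_ball
    (fun k w hw => norm_besselSeries_term_le (hM μ le_rfl)
      (by simpa using (mem_ball_zero_iff.1 hw).le) k) hz
  have hda := (hd.differentiableAt (Metric.isOpen_ball.mem_nhds hz)).hasDerivAt
  refine hda.congr_deriv ?_
  have hs' := (hasSum_nat_add_iff' 1).2 hs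
  simp only [Finset.range_one, Finset.sum_singleton] at hs'
  refine Eq.trans ?_ ((hasSum_besselSeries (μ + 1) z).neg.unique (hs'.congr_fun fun k => ?_)).symm
  · simp
    rfl
  · have hdk : HasDerivAt (fun z : ℂ => (-z) ^ (k + 1) / (k + 1).factorial *
        (Complex.Gamma (μ + (k + 1 : ℕ) + 1))⁻¹)
        (((k + 1 : ℕ) * (-z) ^ k * (-1)) / (k + 1).factorial *
        (Complex.Gamma (μ + (k + 1 : ℕ) + 1))⁻¹) z := by
      have := ((hasDerivAt_neg z).pow (k + 1))
      simp only [Nat.add_sub_cancel] at this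
      exact (this.div_const _).mul_const _
    rw [hdk.deriv, Nat.factorial_succ]
    push_cast
    rw [show μ + (↑k + 1) + 1 = μ + 1 + k + 1 by ring]
    field_simp

theorem besselJ_eq_re (ν x : ℝ) :
    besselJ ν x = (x / 2) ^ ν * (besselSeries ν (x ^ 2 / 4 : ℝ)).re := by
  have h : besselSeries ν (x ^ 2 / 4 : ℝ) = ((∑' k : ℕ, (-1 : ℝ) ^ k * (x ^ 2 / 4) ^ k /
      (k.factorial * Real.Gamma (ν + k + 1)) : ℝ) : ℂ) := by
    rw [besselSeries, Complex.ofReal_tsum]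
    refine tsum_congr fun k => ?_
    push_cast [← Complex.Gamma_ofReal]
    rw [neg_pow, div_mul_eq_div_div, div_eq_mul_inv _ (Complex.Gamma _)]
  rw [h, Complex.ofReal_re, besselJ]

theorem besselSeries_ofReal (ν z : ℝ) :
    besselSeries ν z = ((besselSeries ν z).re : ℂ) := by
  refine Complex.ext rfl ?_
  have h : besselSeries ν z = ((∑' k : ℕ, (-z) ^ k / k.factorial *
      (Real.Gamma (ν + k + 1))⁻¹ : ℝ) : ℂ) := by
    rw [besselSeries, Complex.ofReal_tsum]
    refine tsum_congr fun k => ?_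
    push_cast [← Complex.Gamma_ofReal]
    rfl
  rw [h, Complex.ofReal_im, Complex.ofReal_im]

theorem besselJ_recurrence (ν : ℝ) {x : ℝ} (hx : 0 < x) :
    besselJ ν x = 2 * (ν + 1) / x * besselJ (ν + 1) x - besselJ (ν + 2) x := by
  have h := congrArg Complex.re (besselSeries_recurrence ν (x ^ 2 / 4 : ℝ))
  have h1 : ((ν : ℂ) + 1) = ((ν + 1 : ℝ) : ℂ) := by push_cast; rfl
  have h2 : ((ν : ℂ) + 2) = ((ν + 2 : ℝ) : ℂ) := by push_cast; rfl
  rw [h1, h2, Complex.sub_re, Complex.re_ofReal_mul, Complex.re_ofReal_mul] at h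
  simp only [besselJ_eq_re]
  rw [h, Real.rpow_add (by positivity), Real.rpow_add (by positivity)]
  simp only [Real.rpow_one, Real.rpow_two]
  field_simp
  ring

theorem hasDerivAt_besselJ (ν : ℝ) {x : ℝ} (hx : 0 < x) :
    HasDerivAt (besselJ ν) (ν / x * besselJ ν x - besselJ (ν + 1) x) x := by
  have h0 : HasDerivAt (fun x : ℝ => (x / 2) ^ ν) (1 / 2 * ν * (x / 2) ^ (ν - 1)) x := by
    have := ((hasDerivAt_id x).div_const 2).rpow_const (p := ν) (Or.inl (by positivity))
    simpa using this
  have h1 : HasDerivAt (fun y : ℝ => (besselSeries ν y).re)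
      (-besselSeries (ν + 1) (x ^ 2 / 4 : ℝ)).re
      (x ^ 2 / 4) := (hasDerivAt_besselSeries ν (x ^ 2 / 4 : ℝ)).real_of_complex
  have h2 : HasDerivAt (fun x : ℝ => x ^ 2 / 4) (x / 2) x := by
    refine ((hasDerivAt_pow 2 x).div_const 4).congr_deriv ?_
    norm_num
    ring
  have h3 := h0.mul (h1.comp x h2)
  have h4 : besselJ ν = fun x => (x / 2) ^ ν * (besselSeries ν (x ^ 2 / 4 : ℝ)).re := by
    ext x; exact besselJ_eq_re ν x
  rw [h4]
  refine h3.congr_deriv ?_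
  have h5 : ((ν : ℂ) + 1) = ((ν + 1 : ℝ) : ℂ) := by push_cast; rfl
  simp only [besselJ_eq_re, h5, Complex.neg_re, Function.comp]
  rw [Real.rpow_add (by positivity), Real.rpow_sub (by positivity), Real.rpow_one]
  field_simp
  ring

theorem besselJ_neg_nat (n : ℕ) {x : ℝ} (hx : 0 < x) :
    besselJ (-n) x = (-1) ^ n * besselJ n x := by
  induction n using Nat.twoStepInduction with
  | zero => simp
  | one =>
    have := besselJ_recurrence (-1) hx
    norm_num at this ⊢
    exact this
  | more n ih1 ih2 =>
    have h1 := besselJ_recurrence (-((n + 2 : ℕ) : ℝ)) hx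
    have h2 := besselJ_recurrence (n : ℝ) hx
    push_cast at *
    rw [show -((n : ℝ) + 2) + 1 = -(n + 1) by ring, show -((n : ℝ) + 2) + 2 = -n by ring,
      ih1, ih2, h2] at h1
    rw [h1]
    ring

theorem differentiable_besselJ_order {x : ℝ} (hx : 0 < x) :
    Differentiable ℝ fun μ => besselJ μ x := by
  intro μ
  simp only [besselJ_eq_re]
  have h1 := ((differentiable_besselSeries (x ^ 2 / 4 : ℝ) μ).hasDerivAt.real_of_complex)
  have h2 : DifferentiableAt ℝ (fun μ : ℝ => (x / 2) ^ μ) μ :=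
    ((hasDerivAt_id μ).const_rpow (by positivity : 0 < x / 2)).differentiableAt
  exact h2.mul h1.differentiableAt

theorem continuous_one_sub_sq_rpow {a : ℝ} (ha : 0 < a) :
    Continuous fun s : ℝ => (1 - s ^ 2) ^ a :=
  (by fun_prop : Continuous fun s : ℝ => 1 - s ^ 2).rpow_const fun _ => Or.inr ha.le

theorem integral_one_sub_sq_rpow {a : ℝ} (ha : 0 < a) :
    ∫ s in (0 : ℝ)..1, (1 - s ^ 2) ^ a =
      √π / 2 * Real.Gamma (a + 1) / Real.Gamma (a + 3 / 2) := by
  have hc := continuous_one_sub_sq_rpow ha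
  have h1 : ∫ s in (-1 : ℝ)..1, (1 - s ^ 2) ^ a = 2 * ∫ s in (0 : ℝ)..1, (1 - s ^ 2) ^ a := by
    have h2 := intervalIntegral.integral_comp_neg (a := 0) (b := 1) (fun s : ℝ => (1 - s ^ 2) ^ a)
    simp only [neg_sq, neg_zero] at h2
    rw [← intervalIntegral.integral_add_adjacent_intervals (hc.intervalIntegrable (-1) 0)
      (hc.intervalIntegrable 0 1), ← h2]
    ring
  have h3 := intervalIntegral.mul_integral_comp_mul_add (a := 0) (b := 1)
    (f := fun s : ℝ => (1 - s ^ 2) ^ a) 2 (-1)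
  norm_num at h3
  have h4 : ∫ r in (0 : ℝ)..1, (1 - (2 * r + -1) ^ 2) ^ a
      = 4 ^ a * ∫ r in (0 : ℝ)..1, r ^ a * (1 - r) ^ a := by
    rw [← intervalIntegral.integral_const_mul]
    refine intervalIntegral.integral_congr fun r hr => ?_
    rw [uIcc_of_le zero_le_one] at hr
    have h5 : 0 ≤ 1 - r := sub_nonneg.2 hr.2
    rw [← Real.mul_rpow hr.1 h5, ← Real.mul_rpow (by norm_num) (mul_nonneg hr.1 h5)]
    ring_nf
  have h5 : ((∫ r in (0 : ℝ)..1, r ^ a * (1 - r) ^ a : ℝ) : ℂ)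
      = Complex.betaIntegral ((a + 1 : ℝ) : ℂ) ((a + 1 : ℝ) : ℂ) := by
    rw [Complex.betaIntegral, ← intervalIntegral.integral_ofReal]
    refine intervalIntegral.integral_congr fun r hr => ?_
    rw [uIcc_of_le zero_le_one] at hr
    have h5 : 0 ≤ 1 - r := sub_nonneg.2 hr.2
    push_cast
    rw [Complex.ofReal_cpow hr.1, Complex.ofReal_cpow h5]
    push_cast
    simp
  have h6 := Complex.Gamma_mul_Gamma_eq_betaIntegral (s := ((a + 1 : ℝ) : ℂ))
    (t := ((a + 1 : ℝ) : ℂ)) (by simp; linarith) (by simp; linarith)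
  rw [← h5, ← Complex.ofReal_add, Complex.Gamma_ofReal, Complex.Gamma_ofReal] at h6
  norm_cast at h6
  have h7 := Real.Gamma_mul_Gamma_add_half (a + 1)
  have h8 : (2 : ℝ) ^ (1 - 2 * (a + 1)) = (2 * 4 ^ a)⁻¹ := by
    rw [show (4 : ℝ) = 2 ^ (2 : ℝ) by norm_num, ← Real.rpow_mul (by norm_num),
      show 1 - 2 * (a + 1) = -(1 + 2 * a) by ring, Real.rpow_neg (by norm_num),
      Real.rpow_add (by norm_num), Real.rpow_one]
  rw [h8, show a + 1 + 1 / 2 = a + 3 / 2 by ring] at h7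
  rw [show a + 1 + (a + 1) = 2 * (a + 1) by ring] at h6
  have p1 : 0 < Real.Gamma (a + 1) := Real.Gamma_pos_of_pos (by linarith)
  have p2 : 0 < Real.Gamma (a + 3 / 2) := Real.Gamma_pos_of_pos (by linarith)
  rw [h1, h4] at h3
  set B := ∫ r in (0 : ℝ)..1, r ^ a * (1 - r) ^ a
  set I := ∫ s in (0 : ℝ)..1, (1 - s ^ 2) ^ a
  have h9 : I = 4 ^ a * B := by linarith
  rw [h9]
  rw [eq_div_iff p2.ne']
  have h10 : Real.Gamma (2 * (a + 1)) * √π =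
      2 * 4 ^ a * (Real.Gamma (a + 1) * Real.Gamma (a + 3 / 2)) := by
    rw [h7]; field_simp
  have h11 : Real.Gamma (a + 1) * (4 ^ a * B * Real.Gamma (a + 3 / 2)) =
      Real.Gamma (a + 1) * (√π / 2 * Real.Gamma (a + 1)) := by
    linear_combination (-B / 2) * h10 - √π / 2 * h6
  exact mul_left_cancel₀ p1.ne' h11

theorem integral_one_sub_sq_rpow_mul_pow {a : ℝ} (ha : 0 < a) (k : ℕ) :
    ∫ s in (0 : ℝ)..1, (1 - s ^ 2) ^ a * s ^ (2 * k) =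
      √π / 2 * Real.Gamma (a + 1) * ((2 * k).factorial / (4 ^ k * k.factorial)) /
        Real.Gamma (a + k + 3 / 2) := by
  have hc := continuous_one_sub_sq_rpow ha
  induction k with
  | zero => simpa using integral_one_sub_sq_rpow ha
  | succ k ih =>
    have hd : ∀ s ∈ Ioo (0 : ℝ) 1, HasDerivAt (fun s : ℝ => (1 - s ^ 2) ^ (a + 1) * s ^ (2 * k + 1))
        ((2 * k + 1) * ((1 - s ^ 2) ^ a * s ^ (2 * k)) -
          (2 * a + 2 * k + 3) * ((1 - s ^ 2) ^ a * s ^ (2 * (k + 1)))) s := by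
      intro s hs
      have h0 : 0 < 1 - s ^ 2 := by nlinarith [hs.1, hs.2]
      have h1 := ((hasDerivAt_pow 2 s).const_sub 1).rpow_const (p := a + 1) (Or.inl h0.ne')
      refine (h1.mul (hasDerivAt_pow (2 * k + 1) s)).congr_deriv ?_
      rw [show a + 1 - 1 = a by ring, Real.rpow_add h0, Real.rpow_one]
      push_cast
      ring
    have hcont : Continuous fun s : ℝ => (1 - s ^ 2) ^ (a + 1) * s ^ (2 * k + 1) :=
      (continuous_one_sub_sq_rpow (by linarith)).mul (by fun_prop)
    have i1 : IntervalIntegrable (fun s : ℝ => (1 - s ^ 2) ^ a * s ^ (2 * k)) volume 0 1 :=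
      (hc.mul (by fun_prop)).intervalIntegrable _ _
    have i2 : IntervalIntegrable (fun s : ℝ => (1 - s ^ 2) ^ a * s ^ (2 * (k + 1))) volume 0 1 :=
      (hc.mul (by fun_prop)).intervalIntegrable _ _
    have h := intervalIntegral.integral_eq_sub_of_hasDerivAt_of_le zero_le_one
      hcont.continuousOn hd ((i1.const_mul _).sub (i2.const_mul _))
    rw [intervalIntegral.integral_sub (i1.const_mul _) (i2.const_mul _),
      intervalIntegral.integral_const_mul, intervalIntegral.integral_const_mul, ih] at h
    have h0 : a + 1 ≠ 0 := by linarith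
    simp [Real.zero_rpow h0] at h
    have hg : Real.Gamma (a + (k + 1 : ℕ) + 3 / 2) =
        (a + k + 3 / 2) * Real.Gamma (a + k + 3 / 2) := by
      rw [← Real.Gamma_add_one (by positivity)]
      push_cast
      ring_nf
    rw [hg, show 2 * (k + 1) = 2 * k + 1 + 1 by ring, Nat.factorial_succ,
      Nat.factorial_succ (2 * k),
      Nat.factorial_succ k]
    rw [show 2 * (k + 1) = 2 * k + 1 + 1 by ring] at h
    have p2 : (0 : ℝ) < 2 * a + 2 * k + 3 := by positivity
    have h' := (sub_eq_zero.1 h).symm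
    rw [mul_comm, ← eq_div_iff p2.ne'] at h'
    rw [h']
    push_cast
    field_simp
    ring

/-- Poisson's integral, in terms of the Bessel function of order `a + 1/2`. -/
theorem integral_one_sub_sq_rpow_mul_cos {a : ℝ} (ha : 0 < a) {t : ℝ} (ht : 0 < t) :
    (t / 2) ^ (a + 1 / 2) * ∫ s in (0 : ℝ)..1, (1 - s ^ 2) ^ a * Real.cos (t * s) =
      √π / 2 * Real.Gamma (a + 1) * besselJ (a + 1 / 2) t := by
  have hc := continuous_one_sub_sq_rpow ha
  have h : HasSum (fun k : ℕ => ∫ s in (0 : ℝ)..1,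
      (1 - s ^ 2) ^ a * ((-1) ^ k * (t * s) ^ (2 * k) / (2 * k).factorial))
      (∫ s in (0 : ℝ)..1, (1 - s ^ 2) ^ a * Real.cos (t * s)) := by
    have hs : Summable fun k : ℕ => t ^ (2 * k) / (2 * k).factorial :=
      (Real.summable_pow_div_factorial t).comp_injective (fun a b h => by simpa using h)
    refine intervalIntegral.hasSum_integral_of_dominated_convergence
      (fun k _ => t ^ (2 * k) / (2 * k).factorial) ?_ ?_ ?_ ?_ ?_
    · intro k
      exact (hc.mul (by fun_prop)).aestronglyMeasurable
    · refine fun k => Eventually.of_forall fun s hs => ?_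
      rw [uIoc_of_le zero_le_one] at hs
      have h0 : 0 ≤ 1 - s ^ 2 := by nlinarith [hs.1, hs.2]
      rw [norm_mul, norm_div, norm_mul, norm_pow, norm_neg, norm_one, one_pow, one_mul,
        Real.norm_of_nonneg (Real.rpow_nonneg h0 _), Real.norm_natCast, norm_pow, norm_mul,
        Real.norm_of_nonneg ht.le, Real.norm_of_nonneg hs.1.le]
      have h1 : (1 - s ^ 2) ^ a ≤ 1 := Real.rpow_le_one h0 (by nlinarith) ha.le
      have h2 : (t * s) ^ (2 * k) ≤ t ^ (2 * k) :=
        pow_le_pow_left₀ (mul_nonneg ht.le hs.1.le) (mul_le_of_le_one_right ht.le hs.2) _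
      calc (1 - s ^ 2) ^ a * ((t * s) ^ (2 * k) / (2 * k).factorial)
          ≤ 1 * (t ^ (2 * k) / (2 * k).factorial) := by
            gcongr
            exact div_nonneg (pow_nonneg (mul_nonneg ht.le hs.1.le) _) (by positivity)
        _ = _ := one_mul _
    · exact Eventually.of_forall fun s _ => hs
    · simp
    · refine Eventually.of_forall fun s _ => ?_
      exact (Real.hasSum_cos (t * s)).mul_left _
  have h1 : ∀ k : ℕ, ∫ s in (0 : ℝ)..1,
      (1 - s ^ 2) ^ a * ((-1) ^ k * (t * s) ^ (2 * k) / (2 * k).factorial) =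
      √π / 2 * Real.Gamma (a + 1) * ((-1) ^ k * (t ^ 2 / 4) ^ k /
        (k.factorial * Real.Gamma (a + 1 / 2 + k + 1))) := by
    intro k
    have h3 : ∀ s : ℝ, (1 - s ^ 2) ^ a * ((-1) ^ k * (t * s) ^ (2 * k) / (2 * k).factorial) =
        ((-1) ^ k * t ^ (2 * k) / (2 * k).factorial) * ((1 - s ^ 2) ^ a * s ^ (2 * k)) := by
      intro s
      rw [mul_pow]
      ring
    simp_rw [h3]
    rw [intervalIntegral.integral_const_mul, integral_one_sub_sq_rpow_mul_pow ha,
      show a + 1 / 2 + k + 1 = a + k + 3 / 2 by ring, div_pow, ← pow_mul]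
    generalize Real.Gamma (a + k + 3 / 2) = G at *
    field_simp
  rw [← h.tsum_eq, besselJ, tsum_congr h1, tsum_mul_left]
  ring

theorem Complex.ofReal_mul_cpow_of_nonneg {y : ℝ} (hy : 0 ≤ y) (w : ℂ) {a : ℝ} (ha : 0 < a) :
    ((y : ℂ) * w) ^ (a : ℂ) = ((y ^ a : ℝ) : ℂ) * w ^ (a : ℂ) := by
  have ha' : (a : ℂ) ≠ 0 := by exact_mod_cast ha.ne'
  rcases hy.eq_or_lt with rfl | hy
  · simp [Complex.zero_cpow ha', Real.zero_rpow ha.ne']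
  rcases eq_or_ne w 0 with rfl | hw
  · simp [Complex.zero_cpow ha']
  have hy' : (y : ℂ) ≠ 0 := by exact_mod_cast hy.ne'
  rw [Complex.cpow_def_of_ne_zero (mul_ne_zero hy' hw), Complex.cpow_def_of_ne_zero hw,
    Complex.log_ofReal_mul hy hw, add_mul, Complex.exp_add, Complex.ofReal_cpow hy.le,
    Complex.cpow_def_of_ne_zero hy', Complex.ofReal_log hy.le]

theorem integral_one_sub_sq_rpow_mul_cos_eq_rotated {a : ℝ} (ha : 0 < a) (t : ℝ) :
    ∫ s in (0 : ℝ)..1, (1 - s ^ 2) ^ a * Real.cos (t * s) =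
      (∫ s in (0 : ℝ)..1, (1 - ((s : ℂ) + Complex.I) ^ 2) ^ (a : ℂ) *
        Complex.exp (Complex.I * t * (s + Complex.I))).re -
      (Complex.I * ∫ y in (0 : ℝ)..1, (1 - (1 + (y : ℂ) * Complex.I) ^ 2) ^ (a : ℂ) *
        Complex.exp (Complex.I * t * (1 + y * Complex.I))).re := by
  set f : ℂ → ℂ := fun s => (1 - s ^ 2) ^ (a : ℂ) * Complex.exp (Complex.I * t * s) with hf
  have hcont : ContinuousOn f (Set.uIcc (0 : ℂ).re (1 + Complex.I).re ×ℂ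
      Set.uIcc (0 : ℂ).im (1 + Complex.I).im) := by
    intro s hs
    simp only [Complex.zero_re, Complex.add_re, Complex.one_re, Complex.I_re, add_zero,
      Complex.zero_im, Complex.add_im, Complex.one_im, Complex.I_im, zero_add,
      uIcc_of_le zero_le_one, Complex.mem_reProdIm, mem_Icc] at hs
    refine ContinuousAt.continuousWithinAt (ContinuousAt.mul ?_ (by fun_prop))
    refine (Complex.continuousAt_cpow_const_of_re_pos ?_ (by simpa using ha)).comp (by fun_prop)
    left
    simp [sq]
    nlinarith
  have hdiff : DifferentiableOn ℂ f (Ioo (min (0 : ℂ).re (1 + Complex.I).re)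
      (max (0 : ℂ).re (1 + Complex.I).re) ×ℂ Ioo (min (0 : ℂ).im (1 + Complex.I).im)
      (max (0 : ℂ).im (1 + Complex.I).im)) := by
    intro s hs
    simp only [Complex.zero_re, Complex.add_re, Complex.one_re, Complex.I_re, add_zero,
      Complex.zero_im, Complex.add_im, Complex.one_im, Complex.I_im, zero_add,
      min_eq_left zero_le_one, max_eq_right zero_le_one, Complex.mem_reProdIm, mem_Ioo] at hs
    have hslit : 1 - s ^ 2 ∈ Complex.slitPlane := by
      refine Or.inr ?_
      simp [sq]
      have := mul_pos hs.1.1 hs.2.1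
      nlinarith
    refine DifferentiableAt.differentiableWithinAt (DifferentiableAt.mul ?_ (by fun_prop))
    exact (by fun_prop : DifferentiableAt ℂ (fun s : ℂ => 1 - s ^ 2) s).cpow_const hslit
  have h := Complex.integral_boundary_rect_eq_zero_of_continuousOn_of_differentiableOn f 0
    (1 + Complex.I) hcont hdiff
  simp only [Complex.zero_re, Complex.add_re, Complex.one_re, Complex.I_re, add_zero,
      Complex.zero_im, Complex.add_im, Complex.one_im, Complex.I_im, zero_add,
      Complex.ofReal_zero, Complex.ofReal_one, zero_mul, one_mul, smul_eq_mul] at h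
  have hleft : (Complex.I * ∫ y in (0 : ℝ)..1, f (y * Complex.I)).re = 0 := by
    have h1 : ∫ y in (0 : ℝ)..1, f (y * Complex.I) =
        ((∫ y in (0 : ℝ)..1, (1 + y ^ 2) ^ a * Real.exp (-(t * y)) : ℝ) : ℂ) := by
      rw [← intervalIntegral.integral_ofReal]
      refine intervalIntegral.integral_congr fun y _ => ?_
      simp only [hf]
      push_cast
      rw [Complex.ofReal_cpow (by positivity), mul_pow, Complex.I_sq,
        show Complex.I * t * (y * Complex.I) = -(t * y) by
          linear_combination (t * y : ℂ) * Complex.I_mul_I]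
      push_cast
      ring_nf
    rw [h1]
    simp
  have hbot : (∫ x in (0 : ℝ)..1, f x).re =
      ∫ s in (0 : ℝ)..1, (1 - s ^ 2) ^ a * Real.cos (t * s) := by
    have h2 : IntervalIntegrable (fun x : ℝ => f x) volume 0 1 := by
      refine ContinuousOn.intervalIntegrable ?_
      refine hcont.comp Complex.continuous_ofReal.continuousOn ?_
      intro x hx
      rw [uIcc_of_le zero_le_one] at hx
      simpa [Complex.mem_reProdIm] using hx
    have h1 := Complex.reCLM.intervalIntegral_comp_comm h2
    simp only [Complex.reCLM_apply] at h1
    rw [← h1]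
    refine intervalIntegral.integral_congr fun s hs => ?_
    rw [uIcc_of_le zero_le_one] at hs
    have h0 : 0 ≤ 1 - s ^ 2 := by nlinarith [hs.1, hs.2]
    have h3 : f s = (((1 - s ^ 2) ^ a : ℝ) : ℂ) * Complex.exp (((t * s : ℝ) : ℂ) * Complex.I) := by
      simp only [hf]
      rw [Complex.ofReal_cpow h0]
      push_cast
      ring_nf
    rw [h3, Complex.re_ofReal_mul, Complex.exp_ofReal_mul_I_re]
  have h' := congrArg Complex.re h
  simp only [Complex.add_re, Complex.sub_re, Complex.zero_re] at h'
  rw [hleft, hbot] at h'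
  simp only [hf] at h'
  linarith

theorem tendsto_rotated_top {a : ℝ} (ha : 0 < a) :
    Tendsto (fun t : ℝ => ((t ^ (a + 1) : ℝ) : ℂ) *
      ∫ s in (0 : ℝ)..1, (1 - ((s : ℂ) + Complex.I) ^ 2) ^ (a : ℂ) *
        Complex.exp (Complex.I * t * (s + Complex.I))) atTop (𝓝 0) := by
  have h0 :=
    (tendsto_rpow_mul_exp_neg_mul_atTop_nhds_zero (a + 1) 1 one_pos).mul_const ((5 : ℝ) ^ a)
  rw [zero_mul] at h0
  refine squeeze_zero_norm' ?_ h0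
  filter_upwards [eventually_gt_atTop 0] with t ht
  rw [norm_mul, Complex.norm_real, Real.norm_of_nonneg (by positivity), mul_assoc]
  gcongr
  have := intervalIntegral.norm_integral_le_of_norm_le_const (a := 0) (b := 1)
    (C := Real.exp (-1 * t) * 5 ^ a) (f := fun s : ℝ => (1 - ((s : ℂ) + Complex.I) ^ 2) ^ (a : ℂ) *
        Complex.exp (Complex.I * t * (s + Complex.I))) ?_
  · simpa using this
  intro s hs
  rw [uIoc_of_le zero_le_one] at hs
  rw [norm_mul, Complex.norm_cpow_real, Complex.norm_exp, mul_comm]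
  have h1 : (Complex.I * t * (s + Complex.I)).re = -1 * t := by simp
  rw [h1]
  gcongr
  have h2 : ‖(s : ℂ)‖ ≤ 1 := by
    rw [Complex.norm_real, Real.norm_of_nonneg hs.1.le]; exact hs.2
  have h3 : ‖(s : ℂ) + Complex.I‖ ≤ 2 := (norm_add_le _ _).trans (by rw [Complex.norm_I]; linarith)
  refine (norm_sub_le _ _).trans ?_
  rw [norm_pow, norm_one]
  nlinarith [norm_nonneg ((s : ℂ) + Complex.I)]

theorem tendsto_rotated_side {a : ℝ} (ha : 0 < a) :
    Tendsto (fun t : ℝ => ((t ^ (a + 1) : ℝ) : ℂ) * ∫ y in (0 : ℝ)..1,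
        (((y ^ a : ℝ) : ℂ) * (y - 2 * Complex.I) ^ (a : ℂ)) * Real.exp (-(t * y))) atTop
      (𝓝 ((-(2 * Complex.I)) ^ (a : ℂ) * Real.Gamma (a + 1))) := by
  have hint : IntegrableOn (fun u : ℝ => 3 ^ a * (Real.exp (-u) * u ^ a)) (Ioi 0) := by
    have := (Real.GammaIntegral_convergent (s := a + 1) (by linarith)).const_mul (3 ^ a)
    simpa [IntegrableOn] using this
  have hcw : ∀ t : ℝ, Continuous fun u : ℝ => ((u / t : ℝ) - 2 * Complex.I : ℂ) ^ (a : ℂ) := by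
    intro t
    have h1 : Continuous fun u : ℝ => ((u / t : ℝ) - 2 * Complex.I : ℂ) := by fun_prop
    refine continuous_iff_continuousAt.2 fun u => ?_
    exact (Complex.continuousAt_cpow_const_of_re_pos (Or.inr (by simp)) (by simpa using ha)).comp
      h1.continuousAt
  have hlim : Tendsto (fun t : ℝ => ∫ u in Ioi (0 : ℝ), (Ioc 0 t).indicator (fun u : ℝ =>
      (((u ^ a : ℝ) : ℂ) * ((u / t : ℝ) - 2 * Complex.I) ^ (a : ℂ)) * Real.exp (-u)) u) atTop
      (𝓝 (∫ u in Ioi (0 : ℝ), (((u ^ a : ℝ) : ℂ) * (-(2 * Complex.I)) ^ (a : ℂ)) *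
        Real.exp (-u))) := by
    refine tendsto_integral_filter_of_dominated_convergence _ ?_ ?_ hint ?_
    · refine Eventually.of_forall fun t => ?_
      refine AEStronglyMeasurable.indicator ?_ measurableSet_Ioc
      refine Continuous.aestronglyMeasurable ?_
      have h1 : Continuous fun u : ℝ => u ^ a := Real.continuous_rpow_const ha.le
      have h2 := hcw t
      fun_prop
    · filter_upwards [eventually_gt_atTop 0] with t ht
      refine (ae_restrict_mem measurableSet_Ioi).mono fun u hu => ?_
      have hu' : (0 : ℝ) < u := hu
      by_cases hut : u ∈ Ioc 0 t
      · rw [indicator_of_mem hut, norm_mul, norm_mul, Complex.norm_real, Complex.norm_real,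
          Complex.norm_cpow_real, Real.norm_of_nonneg (by positivity),
          Real.norm_of_nonneg (by positivity)]
        have h1 : ‖((u / t : ℝ) - 2 * Complex.I : ℂ)‖ ≤ 3 := by
          refine (norm_sub_le _ _).trans ?_
          rw [norm_mul, Complex.norm_I, Complex.norm_real, Real.norm_of_nonneg (by positivity)]
          have : u / t ≤ 1 := (div_le_one ht).2 hut.2
          norm_num
          linarith
        calc _ ≤ u ^ a * 3 ^ a * Real.exp (-u) := by gcongr
          _ = _ := by ring
      · rw [indicator_of_notMem hut, norm_zero]
        positivity
    · refine (ae_restrict_mem measurableSet_Ioi).mono fun u hu => ?_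
      have hu' : (0 : ℝ) < u := hu
      have h1 : Tendsto (fun t : ℝ => ((u / t : ℝ) - 2 * Complex.I : ℂ)) atTop
          (𝓝 (((0 : ℝ) : ℂ) - 2 * Complex.I)) :=
        ((Complex.continuous_ofReal.tendsto _).comp
          (tendsto_const_nhds.div_atTop tendsto_id)).sub_const _
      rw [Complex.ofReal_zero, zero_sub] at h1
      have h2 : ContinuousAt (fun w : ℂ => w ^ (a : ℂ)) (-(2 * Complex.I)) :=
        Complex.continuousAt_cpow_const_of_re_pos (Or.inr (by simp)) (by simpa using ha)
      have h3 := ((h2.tendsto.comp h1).const_mul ((u ^ a : ℝ) : ℂ)).mul_const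
        ((Real.exp (-u) : ℝ) : ℂ)
      refine h3.congr' ?_
      filter_upwards [eventually_ge_atTop u] with t ht
      rw [indicator_of_mem (show u ∈ Ioc 0 t from ⟨hu', ht⟩)]
      rfl
  have hval : ∫ u in Ioi (0 : ℝ), (((u ^ a : ℝ) : ℂ) * (-(2 * Complex.I)) ^ (a : ℂ)) *
        Real.exp (-u) = (-(2 * Complex.I)) ^ (a : ℂ) * Real.Gamma (a + 1) := by
    rw [Real.Gamma_eq_integral (by linarith), ← integral_complex_ofReal, ← integral_const_mul]
    refine integral_congr_ae (Eventually.of_forall fun u => ?_)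
    simp only [add_sub_cancel_right]
    push_cast
    ring
  rw [← hval]
  refine hlim.congr' ?_
  filter_upwards [eventually_gt_atTop 0] with t ht
  rw [setIntegral_indicator measurableSet_Ioc, inter_eq_right.2 Ioc_subset_Ioi_self,
    ← intervalIntegral.integral_of_le ht.le]
  have hsub := intervalIntegral.smul_integral_comp_mul_left (a := 0) (b := 1) (c := t)
    (f := fun u : ℝ =>
      (((u ^ a : ℝ) : ℂ) * ((u / t : ℝ) - 2 * Complex.I) ^ (a : ℂ)) * Real.exp (-u))
  rw [mul_zero, mul_one] at hsub
  rw [← hsub, ← intervalIntegral.integral_smul, ← intervalIntegral.integral_const_mul]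
  refine intervalIntegral.integral_congr fun y hy => ?_
  rw [uIcc_of_le zero_le_one] at hy
  have e : (t * y) / t = y := by field_simp
  simp only [e]
  rw [Real.mul_rpow ht.le hy.1, Real.rpow_add_one ht.ne', Complex.real_smul]
  push_cast
  ring

theorem tendsto_rpow_mul_integral_cos {a : ℝ} (ha : 0 < a) :
    Tendsto (fun t : ℝ => t ^ (a + 1) * (∫ s in (0 : ℝ)..1, (1 - s ^ 2) ^ a * Real.cos (t * s)) -
      2 ^ a * Real.Gamma (a + 1) * Real.cos (t - (a + 1) * (π / 2))) atTop (𝓝 0) := by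
  have h1 := (Complex.continuous_re.tendsto _).comp (tendsto_rotated_top ha)
  have h2 := (tendsto_rotated_side ha).sub_const
    ((-(2 * Complex.I)) ^ (a : ℂ) * Real.Gamma (a + 1))
  rw [sub_self] at h2
  have h3 : Tendsto (fun t : ℝ => (Complex.I * (Complex.exp (Complex.I * t) *
      (((t ^ (a + 1) : ℝ) : ℂ) * (∫ y in (0 : ℝ)..1,
        (((y ^ a : ℝ) : ℂ) * (y - 2 * Complex.I) ^ (a : ℂ)) * Real.exp (-(t * y))) -
        (-(2 * Complex.I)) ^ (a : ℂ) * Real.Gamma (a + 1)))).re) atTop (𝓝 0) := by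
    refine squeeze_zero_norm (fun t => ?_) (tendsto_zero_iff_norm_tendsto_zero.1 h2)
    refine (Complex.abs_re_le_norm _).trans ?_
    rw [norm_mul, norm_mul, Complex.norm_I, one_mul, mul_comm Complex.I,
      Complex.norm_exp_ofReal_mul_I, one_mul]
  have h4 := h1.sub h3
  rw [Complex.zero_re, sub_zero] at h4
  refine h4.congr' ?_
  filter_upwards [eventually_gt_atTop 0] with t ht
  have hR : (∫ y in (0 : ℝ)..1, (1 - (1 + (y : ℂ) * Complex.I) ^ 2) ^ (a : ℂ) *
        Complex.exp (Complex.I * t * (1 + y * Complex.I))) = Complex.exp (Complex.I * t) *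
      ∫ y in (0 : ℝ)..1,
        (((y ^ a : ℝ) : ℂ) * (y - 2 * Complex.I) ^ (a : ℂ)) * Real.exp (-(t * y)) := by
    rw [← intervalIntegral.integral_const_mul]
    refine intervalIntegral.integral_congr fun y hy => ?_
    rw [uIcc_of_le zero_le_one] at hy
    have e1 : (1 - (1 + (y : ℂ) * Complex.I) ^ 2) = (y : ℂ) * (y - 2 * Complex.I) := by
      linear_combination (-(y : ℂ) ^ 2) * Complex.I_mul_I
    have e2 : Complex.I * t * (1 + y * Complex.I) = Complex.I * t + ((-(t * y) : ℝ) : ℂ) := by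
      push_cast
      linear_combination (t * y : ℂ) * Complex.I_mul_I
    simp only [e1, e2, Complex.exp_add, Complex.ofReal_mul_cpow_of_nonneg hy.1 _ ha,
      Complex.ofReal_exp]
    ring
  have hk : (Complex.I * (Complex.exp (Complex.I * t) *
      ((-(2 * Complex.I)) ^ (a : ℂ) * Real.Gamma (a + 1)))).re =
      - (2 ^ a * Real.Gamma (a + 1) * Real.cos (t - (a + 1) * (π / 2))) := by
    have e1 : (-(2 * Complex.I)) ^ (a : ℂ) =
        ((2 ^ a : ℝ) : ℂ) * Complex.exp (((-(a * (π / 2)) : ℝ) : ℂ) * Complex.I) := by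
      rw [show -(2 * Complex.I) = ((2 : ℝ) : ℂ) * (-Complex.I) by push_cast; ring,
        Complex.ofReal_mul_cpow_of_nonneg zero_le_two _ ha,
        Complex.cpow_def_of_ne_zero (neg_ne_zero.2 Complex.I_ne_zero), Complex.log_neg_I]
      congr 2
      push_cast
      ring
    have e2 : Complex.I = Complex.exp (((π / 2 : ℝ) : ℂ) * Complex.I) := by
      push_cast
      exact Complex.exp_pi_div_two_mul_I.symm
    have e3 : Complex.I * (Complex.exp (Complex.I * t) *
      ((-(2 * Complex.I)) ^ (a : ℂ) * Real.Gamma (a + 1))) =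
      ((2 ^ a * Real.Gamma (a + 1) : ℝ) : ℂ) *
        Complex.exp (((t - (a + 1) * (π / 2) + π : ℝ) : ℂ) * Complex.I) := by
      rw [e1]
      have : ((t - (a + 1) * (π / 2) + π : ℝ) : ℂ) * Complex.I = ((π / 2 : ℝ) : ℂ) * Complex.I +
          Complex.I * t + ((-(a * (π / 2)) : ℝ) : ℂ) * Complex.I := by
        push_cast
        ring
      rw [this, Complex.exp_add, Complex.exp_add, ← e2]
      push_cast
      ring
    rw [e3, Complex.re_ofReal_mul, Complex.exp_ofReal_mul_I_re, Real.cos_add_pi]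
    ring
  simp only [Function.comp_apply]
  rw [integral_one_sub_sq_rpow_mul_cos_eq_rotated ha, hR, Complex.re_ofReal_mul, mul_sub, mul_sub,
    Complex.sub_re, hk, mul_sub]
  have e5 : ∀ A : ℂ, (Complex.I * (Complex.exp (Complex.I * t) *
      (((t ^ (a + 1) : ℝ) : ℂ) * A))).re =
      t ^ (a + 1) * (Complex.I * (Complex.exp (Complex.I * t) * A)).re := by
    intro A
    rw [← Complex.re_ofReal_mul]
    ring_nf
  rw [e5]
  ring

/-- Leading-order behaviour of `J_μ` at infinity. -/
theorem tendsto_besselJ_phase_of_half_lt {μ : ℝ} (hμ : 1 / 2 < μ) :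
    Tendsto (fun t : ℝ => √t * besselJ μ t - √(2 / π) * Real.cos (t - μ * (π / 2) - π / 4))
      atTop (𝓝 0) := by
  obtain ⟨a, rfl⟩ : ∃ a, μ = a + 1 / 2 := ⟨μ - 1 / 2, by ring⟩
  have ha : 0 < a := by linarith
  have h := (tendsto_rpow_mul_integral_cos ha).const_mul (√(2 / π) / (2 ^ a * Real.Gamma (a + 1)))
  rw [mul_zero] at h
  refine h.congr' ?_
  filter_upwards [eventually_gt_atTop 0] with t ht
  have hP := integral_one_sub_sq_rpow_mul_cos ha ht
  set C := ∫ s in (0 : ℝ)..1, (1 - s ^ 2) ^ a * Real.cos (t * s)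
  have hJ : besselJ (a + 1 / 2) t = (t / 2) ^ (a + 1 / 2) * C * 2 / (√π * Real.Gamma (a + 1)) := by
    rw [hP]
    have : √π ≠ 0 := by positivity
    field_simp
  rw [hJ, Real.div_rpow ht.le zero_le_two, Real.rpow_add_one ht.ne', Real.rpow_add ht,
    Real.rpow_add zero_lt_two, ← Real.sqrt_eq_rpow, ← Real.sqrt_eq_rpow,
    Real.sqrt_div zero_le_two,
    show t - (a + 1 / 2) * (π / 2) - π / 4 = t - (a + 1) * (π / 2) by ring]
  have h2 : √2 * √2 = 2 := Real.mul_self_sqrt zero_le_two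
  have h3 : √t * √t = t := Real.mul_self_sqrt ht.le
  have h7 : √2 / √π = 2 / (√2 * √π) := by
    field_simp
    linarith
  have h8 : √t * (t ^ a * √t / (2 ^ a * √2) * C * 2 / (√π * Real.Gamma (a + 1))) =
    (2 / (√2 * √π)) * ((√t * √t) * t ^ a * C / (2 ^ a * Real.Gamma (a + 1))) := by
    field_simp
  rw [h8, h3, h7]
  field_simp

theorem tendsto_besselJ_phase (μ : ℝ) :
    Tendsto (fun t : ℝ => √t * besselJ μ t - √(2 / π) * Real.cos (t - μ * (π / 2) - π / 4))
      atTop (𝓝 0) := by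
  obtain ⟨n, hn⟩ := exists_nat_gt (1 / 2 - μ)
  induction n using Nat.strong_induction_on generalizing μ with
  | _ n ih =>
  rcases lt_or_ge (1 / 2) μ with hμ | hμ
  · exact tendsto_besselJ_phase_of_half_lt hμ
  have hn0 : n ≠ 0 := by
    rintro rfl
    norm_num at hn
    linarith
  have hn1 : ((n - 1 : ℕ) : ℝ) = n - 1 := by
    rw [Nat.cast_sub (by omega)]
    simp
  have h1 := ih (n - 1) (by omega) (μ + 1) (by rw [hn1]; linarith)
  have h2 := ih (n - 1) (by omega) (μ + 2) (by rw [hn1]; linarith)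
  have hb : Tendsto (fun t : ℝ => 2 * (μ + 1) / t * (√t * besselJ (μ + 1) t)) atTop (𝓝 0) := by
    have hc : Tendsto (fun t : ℝ => 2 * (μ + 1) / t) atTop (𝓝 0) :=
      tendsto_const_nhds.div_atTop tendsto_id
    have hd : Tendsto (fun t : ℝ => 2 * (μ + 1) / t *
        (√(2 / π) * Real.cos (t - (μ + 1) * (π / 2) - π / 4))) atTop (𝓝 0) := by
      have hz := (tendsto_zero_iff_norm_tendsto_zero.1 hc).mul_const √(2 / π)
      rw [zero_mul] at hz
      refine squeeze_zero_norm (fun t => ?_) hz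
      rw [norm_mul, norm_mul, Real.norm_of_nonneg (Real.sqrt_nonneg (2 / π))]
      gcongr
      exact mul_le_of_le_one_right (Real.sqrt_nonneg _) (Real.abs_cos_le_one _)
    have he := (hc.mul h1).add hd
    rw [mul_zero, add_zero] at he
    exact he.congr fun t => by ring
  have h := hb.sub h2
  rw [sub_zero] at h
  refine h.congr' ?_
  filter_upwards [eventually_gt_atTop 0] with t ht
  rw [besselJ_recurrence μ ht,
    show t - (μ + 2) * (π / 2) - π / 4 = t - μ * (π / 2) - π / 4 - π by ring,
    Real.cos_sub_pi]
  ring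

/-- The orders at which the quotient defining `besselY` makes sense. -/
def nonIntegers : Set ℝ := {μ : ℝ | ∀ n : ℤ, μ ≠ (n : ℝ)}

noncomputable def besselYQuot (μ x : ℝ) : ℝ :=
  (besselJ μ x * Real.cos (μ * Real.pi) - besselJ (-μ) x) / Real.sin (μ * Real.pi)

theorem nonIntegers_eq : nonIntegers = (range ((↑) : ℤ → ℝ))ᶜ := by
  ext μ
  simp [nonIntegers, eq_comm]

theorem dense_nonIntegers : Dense nonIntegers := by
  rw [nonIntegers_eq]
  exact (countable_range _).dense_compl ℝ

instance nhdsWithin_nonIntegers_neBot (ν : ℝ) : (𝓝[nonIntegers] ν).NeBot :=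
  mem_closure_iff_nhdsWithin_neBot.1 (dense_nonIntegers ν)

theorem add_one_mem_nonIntegers {ν : ℝ} (hν : ν ∈ nonIntegers) : ν + 1 ∈ nonIntegers := by
  intro n hn
  refine hν (n - 1) ?_
  push_cast
  linarith

theorem sin_mul_pi_ne_zero {μ : ℝ} (hμ : μ ∈ nonIntegers) : Real.sin (μ * π) ≠ 0 := by
  intro h
  obtain ⟨n, hn⟩ := Real.sin_eq_zero_iff.1 h
  exact hμ n (mul_right_cancel₀ Real.pi_ne_zero hn.symm)

theorem continuousAt_besselYQuot {μ x : ℝ} (hμ : μ ∈ nonIntegers) (hx : 0 < x) :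
    ContinuousAt (fun μ => besselYQuot μ x) μ := by
  have h1 := (differentiable_besselJ_order hx).continuous
  unfold besselYQuot
  exact ContinuousAt.div (by fun_prop) (by fun_prop) (sin_mul_pi_ne_zero hμ)

theorem exists_tendsto_besselYQuot_nat (n : ℕ) {x : ℝ} (hx : 0 < x) :
    ∃ L, Tendsto (fun μ => besselYQuot μ x) (𝓝[nonIntegers] (n : ℝ)) (𝓝 L) := by
  set f : ℝ → ℝ := fun μ => besselJ μ x * Real.cos (μ * π) - besselJ (-μ) x with hf
  have hJ := differentiable_besselJ_order hx
  have hfd : Differentiable ℝ f := by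
    simp only [hf]
    fun_prop
  have h1 := (hfd (n : ℝ)).hasDerivAt.tendsto_slope
  have h2 : HasDerivAt (fun μ : ℝ => Real.sin (μ * π)) (Real.cos (n * π) * (1 * π)) (n : ℝ) :=
    ((hasDerivAt_id (n : ℝ)).mul_const π).sin
  have hne : Real.cos (n * π) * (1 * π) ≠ 0 := by
    rw [Real.cos_nat_mul_pi]
    positivity
  have hle : 𝓝[nonIntegers] (n : ℝ) ≤ 𝓝[≠] (n : ℝ) :=
    nhdsWithin_mono _ fun μ hμ => by simpa using hμ n
  refine ⟨_, ((h1.div h2.tendsto_slope hne).mono_left hle).congr' ?_⟩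
  filter_upwards [self_mem_nhdsWithin] with μ hμ
  have hμn : μ - n ≠ 0 := sub_ne_zero.2 (by simpa using hμ n)
  have hf0 : f n = 0 := by
    simp only [hf]
    rw [Real.cos_nat_mul_pi, besselJ_neg_nat n hx]
    ring
  change slope f n μ / slope (fun μ : ℝ => Real.sin (μ * π)) n μ = _
  rw [slope_def_field, slope_def_field, hf0, Real.sin_nat_mul_pi, sub_zero, sub_zero,
    div_div_div_cancel_right₀ hμn]
  rfl

theorem tendsto_besselYQuot {ν x : ℝ} (hν : 0 ≤ ν) (hx : 0 < x) :
    Tendsto (fun μ => besselYQuot μ x) (𝓝[nonIntegers] ν) (𝓝 (besselY ν x)) := by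
  refine tendsto_nhds_limUnder ?_
  by_cases h : ν ∈ nonIntegers
  · exact ⟨_, (continuousAt_besselYQuot h hx).tendsto.mono_left nhdsWithin_le_nhds⟩
  · simp only [nonIntegers, mem_ofPred_eq, not_forall, not_not] at h
    obtain ⟨n, rfl⟩ := h
    lift n to ℕ using (by exact_mod_cast hν)
    exact exists_tendsto_besselYQuot_nat n hx

theorem besselY_eq_quot {ν x : ℝ} (hν : ν ∈ nonIntegers) (hx : 0 < x) :
    besselY ν x = besselYQuot ν x :=
  have := nhdsWithin_nonIntegers_neBot ν
  Tendsto.limUnder_eq (f := 𝓝[nonIntegers] ν)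
    ((continuousAt_besselYQuot hν hx).tendsto.mono_left nhdsWithin_le_nhds)

theorem tendsto_besselY_order {ν x : ℝ} (hν : 0 ≤ ν) (hx : 0 < x) :
    Tendsto (fun μ => besselY μ x) (𝓝[nonIntegers] ν) (𝓝 (besselY ν x)) := by
  refine (tendsto_besselYQuot hν hx).congr' ?_
  filter_upwards [self_mem_nhdsWithin] with μ hμ
  exact (besselY_eq_quot hμ hx).symm

theorem besselY_add_one_eq {ν x : ℝ} (hν : ν ∈ nonIntegers) (hx : 0 < x) :
    besselY (ν + 1) x =
      (besselJ (ν + 1) x * Real.cos (ν * π) + besselJ (-ν - 1) x) / Real.sin (ν * π) := by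
  rw [besselY_eq_quot (add_one_mem_nonIntegers hν) hx, besselYQuot, add_mul, one_mul,
    Real.cos_add_pi, Real.sin_add_pi, neg_add']
  field_simp
  ring

theorem besselY_recurrence {ν x : ℝ} (hν : ν ∈ nonIntegers) (hx : 0 < x) :
    besselY ν x = 2 * (ν + 1) / x * besselY (ν + 1) x - besselY (ν + 2) x := by
  have h2 := besselY_add_one_eq (add_one_mem_nonIntegers hν) hx
  rw [add_mul, one_mul, Real.cos_add_pi, Real.sin_add_pi, add_assoc,
    show (1 + 1 : ℝ) = 2 by norm_num, show -(ν + 1) - 1 = -ν - 2 by ring] at h2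
  have h3 := besselJ_recurrence (-ν - 2) hx
  rw [show -ν - 2 + 1 = -ν - 1 by ring, show -ν - 2 + 2 = -ν by ring] at h3
  rw [h2, besselY_add_one_eq hν hx, besselY_eq_quot hν hx, besselYQuot, h3, besselJ_recurrence ν hx]
  field_simp
  ring

theorem hasDerivAt_besselY {ν x : ℝ} (hν : ν ∈ nonIntegers) (hx : 0 < x) :
    HasDerivAt (besselY ν) (ν / x * besselY ν x - besselY (ν + 1) x) x := by
  have h1 := (((hasDerivAt_besselJ ν hx).mul_const (Real.cos (ν * π))).sub
    (hasDerivAt_besselJ (-ν) hx)).div_const (Real.sin (ν * π))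
  have h3 := besselJ_recurrence (-ν - 1) hx
  rw [show -ν - 1 + 1 = -ν by ring, show -ν - 1 + 2 = -ν + 1 by ring] at h3
  refine (h1.congr_of_eventuallyEq ?_).congr_deriv ?_
  · filter_upwards [lt_mem_nhds hx] with t ht
    rw [besselY_eq_quot hν ht]
    rfl
  · rw [besselY_add_one_eq hν hx, besselY_eq_quot hν hx, besselYQuot, h3]
    field_simp
    ring

theorem hasDerivAt_besselJ_add_one (ν : ℝ) {x : ℝ} (hx : 0 < x) :
    HasDerivAt (besselJ (ν + 1)) (besselJ ν x - (ν + 1) / x * besselJ (ν + 1) x) x := by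
  refine (hasDerivAt_besselJ (ν + 1) hx).congr_deriv ?_
  rw [besselJ_recurrence ν hx, show ν + 1 + 1 = ν + 2 by ring]
  ring

theorem hasDerivAt_besselY_add_one {ν x : ℝ} (hν : ν ∈ nonIntegers) (hx : 0 < x) :
    HasDerivAt (besselY (ν + 1)) (besselY ν x - (ν + 1) / x * besselY (ν + 1) x) x := by
  refine (hasDerivAt_besselY (add_one_mem_nonIntegers hν) hx).congr_deriv ?_
  rw [besselY_recurrence hν hx, show ν + 1 + 1 = ν + 2 by ring]
  ring

theorem tendsto_besselY_phase {ν : ℝ} (hν : ν ∈ nonIntegers) :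
    Tendsto (fun t : ℝ => √t * besselY ν t - √(2 / π) * Real.sin (t - ν * (π / 2) - π / 4))
      atTop (𝓝 0) := by
  have hs := sin_mul_pi_ne_zero hν
  have h := (((tendsto_besselJ_phase ν).mul_const (Real.cos (ν * π))).sub
    (tendsto_besselJ_phase (-ν))).div_const (Real.sin (ν * π))
  rw [zero_mul, sub_zero, zero_div] at h
  refine h.congr' ?_
  filter_upwards [eventually_gt_atTop 0] with t ht
  rw [besselY_eq_quot hν ht, besselYQuot,
    show t - -ν * (π / 2) - π / 4 = (t - ν * (π / 2) - π / 4) + ν * π by ring, Real.cos_add]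
  generalize t - ν * (π / 2) - π / 4 = θ
  have e := div_mul_cancel₀ (besselJ ν t * Real.cos (ν * π) - besselJ (-ν) t) hs
  rw [div_eq_iff hs]
  linear_combination (-√t) * e

/-- A bound for `t * f t ^ 2` on `[x, ∞)`, where `f` is a solution of Bessel's equation of order `μ`
with `f x = a` and lowered companion `(μ / x) * f x - f' x = b`. -/
noncomputable def besselEnergyBound (μ x a b : ℝ) : ℝ :=
  (x * a ^ 2 + x * ((μ + 1 / 2) * a / x - b) ^ 2) * Real.exp (|μ ^ 2 - 1 / 4| / x)

theorem mul_sq_le_besselEnergyBound {f g : ℝ → ℝ} {μ : ℝ}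
    (hf : ∀ t, 0 < t → HasDerivAt f (μ / t * f t - g t) t)
    (hg : ∀ t, 0 < t → HasDerivAt g (f t - (μ + 1) / t * g t) t)
    {x t : ℝ} (hx : 0 < x) (hxt : x ≤ t) :
    t * f t ^ 2 ≤ besselEnergyBound μ x (f x) (g x) := by
  set K := |μ ^ 2 - 1 / 4| with hK
  set w : ℝ → ℝ := fun t => (μ + 1 / 2) * f t / t - g t with hw
  set E : ℝ → ℝ := fun t => t * f t ^ 2 + t * w t ^ 2 with hE
  have hE' : ∀ t, 0 < t → HasDerivAt E (2 * w t * f t * (μ ^ 2 - 1 / 4) / t) t := by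
    intro t ht
    have h1 : HasDerivAt w _ t :=
      ((((hf t ht).const_mul (μ + 1 / 2)).div (hasDerivAt_id t) ht.ne').sub (hg t ht))
    have h2 := ((hasDerivAt_id t).mul ((hf t ht).pow 2)).add ((hasDerivAt_id t).mul (h1.pow 2))
    refine h2.congr_deriv ?_
    simp only [hw, id, Nat.cast_ofNat, Nat.add_one_sub_one, pow_one, Pi.pow_apply]
    field_simp
    ring
  have hG' : ∀ t, 0 < t → HasDerivAt (fun t => E t * Real.exp (K / t))
      ((2 * w t * f t * (μ ^ 2 - 1 / 4) / t - K * E t / t ^ 2) * Real.exp (K / t)) t := by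
    intro t ht
    have h1 := ((hasDerivAt_const t K).div (hasDerivAt_id t) ht.ne').exp
    refine ((hE' t ht).mul h1).congr_deriv ?_
    simp only [id, Pi.div_apply]
    field_simp
    ring
  have hanti : AntitoneOn (fun t => E t * Real.exp (K / t)) (Ici x) := by
    refine antitoneOn_of_deriv_nonpos (convex_Ici x)
      (fun s hs => (hG' s (hx.trans_le hs)).continuousAt.continuousWithinAt)
      (fun s hs => ?_) (fun s hs => ?_)
    · rw [interior_Ici] at hs
      exact (hG' s (hx.trans hs)).differentiableAt.differentiableWithinAt
    · rw [interior_Ici] at hs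
      have hs0 : 0 < s := hx.trans hs
      rw [(hG' s hs0).deriv]
      refine mul_nonpos_of_nonpos_of_nonneg ?_ (Real.exp_pos _).le
      have h1 : 2 * w s * f s * (μ ^ 2 - 1 / 4) ≤ (f s ^ 2 + w s ^ 2) * K := by
        refine (le_abs_self _).trans ?_
        rw [abs_mul]
        gcongr
        rw [abs_le]
        constructor <;> nlinarith [sq_nonneg (w s + f s), sq_nonneg (w s - f s)]
      have h2 : K * E s / s ^ 2 = (f s ^ 2 + w s ^ 2) * K / s := by
        simp only [hE]
        field_simp
      rw [h2, ← sub_div]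
      exact div_nonpos_of_nonpos_of_nonneg (by linarith) hs0.le
  have ht : 0 < t := hx.trans_le hxt
  have h3 := hanti (mem_Ici.2 le_rfl) (mem_Ici.2 hxt) hxt
  have h4 : E t ≤ E t * Real.exp (K / t) :=
    le_mul_of_one_le_right (by simp only [hE]; positivity) (Real.one_le_exp (by positivity))
  have h5 : t * f t ^ 2 ≤ E t := by
    simp only [hE]
    have : 0 ≤ t * w t ^ 2 := by positivity
    linarith
  exact h5.trans (h4.trans h3)

theorem mul_besselJ_sq_le (μ : ℝ) {x t : ℝ} (hx : 0 < x) (hxt : x ≤ t) :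
    t * besselJ μ t ^ 2 ≤ besselEnergyBound μ x (besselJ μ x) (besselJ (μ + 1) x) :=
  mul_sq_le_besselEnergyBound (fun _ ht => hasDerivAt_besselJ μ ht)
    (fun _ ht => hasDerivAt_besselJ_add_one μ ht) hx hxt

theorem mul_besselY_sq_le {ν : ℝ} (hν : ν ∈ nonIntegers) {x t : ℝ} (hx : 0 < x) (hxt : x ≤ t) :
    t * besselY ν t ^ 2 ≤ besselEnergyBound ν x (besselY ν x) (besselY (ν + 1) x) :=
  mul_sq_le_besselEnergyBound (fun _ ht => hasDerivAt_besselY hν ht)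
    (fun _ ht => hasDerivAt_besselY_add_one hν ht) hx hxt

theorem tendsto_besselEnergyBound {ι : Type*} {l : Filter ι} {m a b : ι → ℝ}
    {μ A B : ℝ} (x : ℝ) (hm : Tendsto m l (𝓝 μ)) (ha : Tendsto a l (𝓝 A)) (hb : Tendsto b l (𝓝 B)) :
    Tendsto (fun i => besselEnergyBound (m i) x (a i) (b i)) l (𝓝 (besselEnergyBound μ x A B)) := by
  unfold besselEnergyBound
  have h1 : Tendsto (fun i => (m i + 1 / 2) * a i / x - b i) l (𝓝 ((μ + 1 / 2) * A / x - B)) :=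
    (((hm.add_const (1 / 2)).mul ha).div_const x).sub hb
  have h2 : Tendsto (fun i => Real.exp (|m i ^ 2 - 1 / 4| / x)) l
      (𝓝 (Real.exp (|μ ^ 2 - 1 / 4| / x))) :=
    (Real.continuous_exp.tendsto _).comp ((((hm.pow 2).sub_const (1 / 4)).abs).div_const x)
  exact (((ha.pow 2).const_mul x).add ((h1.pow 2).const_mul x)).mul h2

theorem abs_mul_div_le_of_mul_sq_le {t a b A B : ℝ} (ht : 0 < t) (ha : t * a ^ 2 ≤ A)
    (hb : t * b ^ 2 ≤ B) : ‖a * b / t‖ ≤ (A + B) / 2 * t ^ (-2 : ℝ) := by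
  have h1 : t ^ (-2 : ℝ) = 1 / t ^ 2 := by
    rw [Real.rpow_neg ht.le, Real.rpow_two, one_div]
  rw [h1, mul_one_div, norm_div, Real.norm_of_nonneg ht.le, div_le_div_iff₀ ht (by positivity),
    Real.norm_eq_abs]
  have h2 : |a * b| ≤ (a ^ 2 + b ^ 2) / 2 := by
    rw [abs_le]
    constructor <;> nlinarith [sq_nonneg (a + b), sq_nonneg (a - b)]
  calc |a * b| * t ^ 2 ≤ (a ^ 2 + b ^ 2) / 2 * t ^ 2 := by gcongr
    _ = (t * a ^ 2 + t * b ^ 2) / 2 * t := by ring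
    _ ≤ (A + B) / 2 * t := by gcongr

theorem continuousOn_besselJ_mul_besselY_div (μ : ℝ) {ν : ℝ} (hν : ν ∈ nonIntegers) {x : ℝ}
    (hx : 0 < x) : ContinuousOn (fun t => besselJ μ t * besselY ν t / t) (Ioi x) := by
  intro t ht
  have ht0 : 0 < t := hx.trans ht
  exact (((hasDerivAt_besselJ μ ht0).continuousAt.mul (hasDerivAt_besselY hν ht0).continuousAt).div
    continuousAt_id ht0.ne').continuousWithinAt

theorem integrableOn_besselJ_mul_besselY_div (μ : ℝ) {ν : ℝ} (hν : ν ∈ nonIntegers) {x : ℝ}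
    (hx : 0 < x) : IntegrableOn (fun t => besselJ μ t * besselY ν t / t) (Ioi x) := by
  refine ((integrableOn_Ioi_rpow_of_lt (by norm_num : (-2 : ℝ) < -1) hx).const_mul
    ((besselEnergyBound μ x (besselJ μ x) (besselJ (μ + 1) x) +
      besselEnergyBound ν x (besselY ν x) (besselY (ν + 1) x)) / 2)).mono'
    ((continuousOn_besselJ_mul_besselY_div μ hν hx).aestronglyMeasurable measurableSet_Ioi)
    ((ae_restrict_mem measurableSet_Ioi).mono fun t ht => ?_)
  have ht' : x < t := ht
  exact abs_mul_div_le_of_mul_sq_le (hx.trans ht') (mul_besselJ_sq_le μ hx ht'.le)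
    (mul_besselY_sq_le hν hx ht'.le)

theorem tendsto_integral_besselJ_mul_besselY_div {ι : Type*} {l : Filter ι}
    [l.IsCountablyGenerated] {m n : ι → ℝ} {ν : ℝ} (hν : 0 ≤ ν) (hm : Tendsto m l (𝓝 ν))
    (hn : Tendsto n l (𝓝[nonIntegers] ν)) {x : ℝ} (hx : 0 < x) :
    Tendsto (fun i => ∫ t in Ioi x, besselJ (m i) t * besselY (n i) t / t) l
      (𝓝 (∫ t in Ioi x, besselJ ν t * besselY ν t / t)) := by
  have hn' : Tendsto n l (𝓝 ν) := hn.mono_right nhdsWithin_le_nhds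
  have hnN : ∀ᶠ i in l, n i ∈ nonIntegers := hn.eventually self_mem_nhdsWithin
  have hn1 : Tendsto (fun i => n i + 1) l (𝓝[nonIntegers] (ν + 1)) :=
    tendsto_nhdsWithin_iff.2 ⟨hn'.add_const 1, hnN.mono fun i hi => add_one_mem_nonIntegers hi⟩
  have hJ : ∀ t, 0 < t → Tendsto (fun i => besselJ (m i) t) l (𝓝 (besselJ ν t)) := fun t ht =>
    ((differentiable_besselJ_order ht).continuous.tendsto ν).comp hm
  have hY : ∀ t, 0 < t → Tendsto (fun i => besselY (n i) t) l (𝓝 (besselY ν t)) := fun t ht =>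
    (tendsto_besselY_order hν ht).comp hn
  have hJ1 : Tendsto (fun i => besselJ (m i + 1) x) l (𝓝 (besselJ (ν + 1) x)) :=
    ((differentiable_besselJ_order hx).continuous.tendsto (ν + 1)).comp (hm.add_const 1)
  have hY1 : Tendsto (fun i => besselY (n i + 1) x) l (𝓝 (besselY (ν + 1) x)) :=
    (tendsto_besselY_order (by linarith) hx).comp hn1
  have hEJ := (tendsto_besselEnergyBound x hm (hJ x hx) hJ1).eventually_le_const
    (lt_add_one _)
  have hEY := (tendsto_besselEnergyBound x hn' (hY x hx) hY1).eventually_le_const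
    (lt_add_one _)
  refine tendsto_integral_filter_of_dominated_convergence _ ?_ ?_
    ((integrableOn_Ioi_rpow_of_lt (by norm_num : (-2 : ℝ) < -1) hx).const_mul
      (((besselEnergyBound ν x (besselJ ν x) (besselJ (ν + 1) x) + 1) +
        (besselEnergyBound ν x (besselY ν x) (besselY (ν + 1) x) + 1)) / 2)) ?_
  · filter_upwards [hnN] with i hi
    exact (continuousOn_besselJ_mul_besselY_div _ hi hx).aestronglyMeasurable measurableSet_Ioi
  · filter_upwards [hnN, hEJ, hEY] with i hi h1 h2
    refine (ae_restrict_mem measurableSet_Ioi).mono fun t ht => ?_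
    have ht' : x < t := ht
    exact abs_mul_div_le_of_mul_sq_le (hx.trans ht') ((mul_besselJ_sq_le _ hx ht'.le).trans h1)
      ((mul_besselY_sq_le hi hx ht'.le).trans h2)
  · refine (ae_restrict_mem measurableSet_Ioi).mono fun t ht => ?_
    have ht0 : 0 < t := hx.trans ht
    exact ((hJ t ht0).mul (hY t ht0)).div_const t

theorem tendsto_mul_sub_mul_of_abs_le {ι : Type*} {l : Filter ι} {u U v V : ι → ℝ} {B : ℝ}
    (hu : Tendsto (fun i => u i - U i) l (𝓝 0)) (hv : Tendsto (fun i => v i - V i) l (𝓝 0))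
    (hU : ∀ i, |U i| ≤ B) (hV : ∀ i, |V i| ≤ B) :
    Tendsto (fun i => u i * v i - U i * V i) l (𝓝 0) := by
  have h1 : Tendsto (fun i => U i * (v i - V i)) l (𝓝 0) := by
    refine squeeze_zero_norm (fun i => ?_)
      (by simpa using (tendsto_zero_iff_norm_tendsto_zero.1 hv).const_mul B)
    rw [norm_mul]
    exact mul_le_mul_of_nonneg_right (hU i) (norm_nonneg _)
  have h2 : Tendsto (fun i => V i * (u i - U i)) l (𝓝 0) := by
    refine squeeze_zero_norm (fun i => ?_)
      (by simpa using (tendsto_zero_iff_norm_tendsto_zero.1 hu).const_mul B)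
    rw [norm_mul]
    exact mul_le_mul_of_nonneg_right (hV i) (norm_nonneg _)
  have h3 := ((hu.mul hv).add h1).add h2
  simp only [mul_zero, add_zero] at h3
  exact h3.congr fun i => by ring

/-- The generalized Wronskian of `J_μ` and `Y_ν`. -/
noncomputable def besselCross (μ ν t : ℝ) : ℝ :=
  (μ - ν) * (besselJ μ t * besselY ν t) +
    t * (besselJ μ t * besselY (ν + 1) t - besselJ (μ + 1) t * besselY ν t)

theorem hasDerivAt_besselCross (μ : ℝ) {ν : ℝ} (hν : ν ∈ nonIntegers) {t : ℝ} (ht : 0 < t) :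
    HasDerivAt (besselCross μ ν) ((μ ^ 2 - ν ^ 2) * (besselJ μ t * besselY ν t / t)) t := by
  have hf := hasDerivAt_besselJ μ ht
  have hg := hasDerivAt_besselJ_add_one μ ht
  have hh := hasDerivAt_besselY hν ht
  have hk := hasDerivAt_besselY_add_one hν ht
  have h : HasDerivAt (besselCross μ ν) _ t := ((hf.mul hh).const_mul (μ - ν)).add
    ((hasDerivAt_id t).mul ((hf.mul hk).sub (hg.mul hh)))
  refine h.congr_deriv ?_
  simp only [id]
  field_simp
  ring

theorem tendsto_besselCross (μ : ℝ) {ν : ℝ} (hν : ν ∈ nonIntegers) :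
    Tendsto (besselCross μ ν) atTop (𝓝 (-(2 / π) * Real.cos ((μ - ν) * (π / 2)))) := by
  have hc : ∀ y, |√(2 / π) * Real.cos y| ≤ √(2 / π) := fun y => by
    rw [abs_mul, abs_of_nonneg (Real.sqrt_nonneg _)]
    exact mul_le_of_le_one_right (Real.sqrt_nonneg _) (Real.abs_cos_le_one _)
  have hs : ∀ y, |√(2 / π) * Real.sin y| ≤ √(2 / π) := fun y => by
    rw [abs_mul, abs_of_nonneg (Real.sqrt_nonneg _)]
    exact mul_le_of_le_one_right (Real.sqrt_nonneg _) (Real.abs_sin_le_one _)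
  have hJ := tendsto_besselJ_phase μ
  have hJ1 := tendsto_besselJ_phase (μ + 1)
  have hY := tendsto_besselY_phase hν
  have hY1 := tendsto_besselY_phase (add_one_mem_nonIntegers hν)
  have h1 := tendsto_mul_sub_mul_of_abs_le hJ hY1 (fun _ => hc _) (fun _ => hs _)
  have h2 := tendsto_mul_sub_mul_of_abs_le hJ1 hY (fun _ => hc _) (fun _ => hs _)
  have h3 : Tendsto (fun t => (μ - ν) * (besselJ μ t * besselY ν t)) atTop (𝓝 0) := by
    set A := besselEnergyBound μ 1 (besselJ μ 1) (besselJ (μ + 1) 1)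
    set B := besselEnergyBound ν 1 (besselY ν 1) (besselY (ν + 1) 1)
    have h4 : Tendsto (fun t : ℝ => |μ - ν| * ((A + B) / 2) / t) atTop (𝓝 0) :=
      tendsto_const_nhds.div_atTop tendsto_id
    refine squeeze_zero_norm' ?_ h4
    filter_upwards [eventually_ge_atTop 1] with t ht
    have ht0 : 0 < t := by linarith
    have h5 := abs_mul_div_le_of_mul_sq_le ht0 (mul_besselJ_sq_le μ one_pos ht)
      (mul_besselY_sq_le hν one_pos ht)
    rw [norm_div, Real.norm_of_nonneg ht0.le, div_le_iff₀ ht0, Real.rpow_neg ht0.le,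
      Real.rpow_two] at h5
    rw [norm_mul, Real.norm_eq_abs, mul_div_assoc]
    gcongr
    refine h5.trans (le_of_eq ?_)
    field_simp
    rfl
  have h6 := h3.add ((h1.sub h2).add_const (-(2 / π) * Real.cos ((μ - ν) * (π / 2))))
  rw [sub_zero, zero_add, zero_add] at h6
  refine h6.congr' ?_
  filter_upwards [eventually_gt_atTop 0] with t ht
  have e1 : √(2 / π) * √(2 / π) = 2 / π := Real.mul_self_sqrt (by positivity)
  have e2 : √t * √t = t := Real.mul_self_sqrt ht.le
  rw [besselCross, show t - (ν + 1) * (π / 2) - π / 4 = (t - ν * (π / 2) - π / 4) - π / 2 by ring,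
    show t - (μ + 1) * (π / 2) - π / 4 = (t - μ * (π / 2) - π / 4) - π / 2 by ring,
    show (μ - ν) * (π / 2) = (t - ν * (π / 2) - π / 4) - (t - μ * (π / 2) - π / 4) by ring,
    Real.sin_sub_pi_div_two, Real.cos_sub_pi_div_two]
  generalize t - ν * (π / 2) - π / 4 = b
  generalize t - μ * (π / 2) - π / 4 = a
  rw [Real.cos_sub]
  linear_combination (besselJ μ t * besselY (ν + 1) t - besselJ (μ + 1) t * besselY ν t) * e2 +
    (Real.cos a * Real.cos b + Real.sin a * Real.sin b) * e1

theorem sq_sub_sq_mul_integral_besselJ_mul_besselY (μ : ℝ) {ν : ℝ} (hν : ν ∈ nonIntegers) {x : ℝ}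
    (hx : 0 < x) : (μ ^ 2 - ν ^ 2) * ∫ t in Ioi x, besselJ μ t * besselY ν t / t =
      -(2 / π) * Real.cos ((μ - ν) * (π / 2)) - besselCross μ ν x := by
  rw [← integral_const_mul]
  exact integral_Ioi_of_hasDerivAt_of_tendsto'
    (fun t ht => hasDerivAt_besselCross μ hν (hx.trans_le ht))
    ((integrableOn_besselJ_mul_besselY_div μ hν hx).const_mul _) (tendsto_besselCross μ hν)

theorem besselJ_mul_besselY_wronskian {ν : ℝ} (hν : ν ∈ nonIntegers) {x : ℝ} (hx : 0 < x) :
    x * (besselJ ν x * besselY (ν + 1) x - besselJ (ν + 1) x * besselY ν x) = -(2 / π) := by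
  have h := sq_sub_sq_mul_integral_besselJ_mul_besselY ν hν hx
  rw [besselCross] at h
  simp only [sub_self, zero_mul, Real.cos_zero] at h
  linarith

theorem two_mul_integral_besselJ_mul_besselY {ν : ℝ} (hν0 : 0 ≤ ν) (hν : ν ∈ nonIntegers) {x : ℝ}
    (hx : 0 < x) {a b : ℝ} (ha : HasDerivAt (fun μ => besselJ μ x) a ν)
    (hb : HasDerivAt (fun μ => besselJ μ x) b (ν + 1)) :
    2 * ν * ∫ t in Ioi x, besselJ ν t * besselY ν t / t =
      -(besselJ ν x * besselY ν x) + x * (b * besselY ν x) - x * (a * besselY (ν + 1) x) := by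
  have hb' : HasDerivAt (fun μ => besselJ (μ + 1) x) b ν := hb.comp_add_const ν 1
  have hid := (hasDerivAt_id ν).sub_const ν
  have hcos := ((hid.mul_const (π / 2)).cos).const_mul (-(2 / π))
  have hP := ((hid.mul (ha.mul_const (besselY ν x))).add
    (((ha.mul_const (besselY (ν + 1) x)).sub (hb'.mul_const (besselY ν x))).const_mul x))
  have hΦ : HasDerivAt (fun μ => -(2 / π) * Real.cos ((μ - ν) * (π / 2)) - besselCross μ ν x) _ ν :=
    hcos.sub hP
  have h1 := hΦ.tendsto_slope
  have h2 : Tendsto (fun μ => (μ + ν) * ∫ t in Ioi x, besselJ μ t * besselY ν t / t) (𝓝[≠] ν)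
      (𝓝 ((ν + ν) * ∫ t in Ioi x, besselJ ν t * besselY ν t / t)) := by
    refine Tendsto.mul ?_ ?_
    · exact (tendsto_id.add_const ν).mono_left nhdsWithin_le_nhds
    · exact tendsto_integral_besselJ_mul_besselY_div hν0
        (tendsto_id.mono_left nhdsWithin_le_nhds)
        ((tendsto_const_pure.mono_right (pure_le_nhdsWithin hν))) hx
  have h3 := tendsto_nhds_unique (h2.congr' ?_) h1
  · rw [← two_mul] at h3
    rw [h3]
    simp only [id, sub_self, zero_mul, Real.sin_zero]
    ring
  · filter_upwards [self_mem_nhdsWithin] with μ hμ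
    have hμ' : μ - ν ≠ 0 := sub_ne_zero.2 hμ
    rw [slope_def_field, ← sq_sub_sq_mul_integral_besselJ_mul_besselY μ hν hx,
      ← sq_sub_sq_mul_integral_besselJ_mul_besselY ν hν hx]
    field_simp
    ring

theorem hasDerivAt_log_Gamma {s : ℝ} (hs : 0 < s) :
    HasDerivAt (Real.log ∘ Real.Gamma) (logDeriv Real.Gamma s) s := by
  have hd : DifferentiableAt ℝ Real.Gamma s := Real.differentiableAt_Gamma fun m => by
    have : (0 : ℝ) ≤ m := m.cast_nonneg
    linarith
  exact hd.hasDerivAt.log (Real.Gamma_pos_of_pos hs).ne'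

theorem log_Gamma_add_one {s : ℝ} (hs : 0 < s) :
    Real.log (Real.Gamma (s + 1)) = Real.log s + Real.log (Real.Gamma s) := by
  rw [Real.Gamma_add_one hs.ne', Real.log_mul hs.ne' (Real.Gamma_pos_of_pos hs).ne']

theorem logDeriv_Gamma_add_one {s : ℝ} (hs : 0 < s) :
    logDeriv Real.Gamma (s + 1) = logDeriv Real.Gamma s + 1 / s := by
  have h1 := (hasDerivAt_log_Gamma (by linarith : 0 < s + 1)).comp_add_const s 1
  have h2 := (Real.hasDerivAt_log hs.ne').add (hasDerivAt_log_Gamma hs)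
  rw [h1.unique (h2.congr_of_eventuallyEq ?_), one_div, add_comm]
  filter_upwards [lt_mem_nhds hs] with t ht
  exact log_Gamma_add_one ht

theorem log_le_logDeriv_Gamma_add_one {s : ℝ} (hs : 0 < s) :
    Real.log s ≤ logDeriv Real.Gamma (s + 1) := by
  have hs1 : 0 < s + 1 := by linarith
  have h := Real.convexOn_log_Gamma.slope_le_of_hasDerivAt (mem_Ioi.2 hs) (mem_Ioi.2 hs1)
    (lt_add_one s) (hasDerivAt_log_Gamma hs1)
  rw [slope_def_field] at h
  simpa [log_Gamma_add_one hs] using h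

theorem logDeriv_Gamma_le_log {s : ℝ} (hs : 0 < s) : logDeriv Real.Gamma s ≤ Real.log s := by
  have hs1 : 0 < s + 1 := by linarith
  have h := Real.convexOn_log_Gamma.le_slope_of_hasDerivAt (mem_Ioi.2 hs) (mem_Ioi.2 hs1)
    (lt_add_one s) (hasDerivAt_log_Gamma hs)
  rw [slope_def_field] at h
  simpa [log_Gamma_add_one hs] using h

/-- The error of the two-term expansion of the digamma function. -/
noncomputable def digammaError (s : ℝ) : ℝ :=
  logDeriv Real.Gamma (s + 1) - Real.log s - 1 / (2 * s)

theorem tendsto_digammaError : Tendsto digammaError atTop (𝓝 0) := by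
  have h1 : Tendsto (fun s : ℝ => 1 / s) atTop (𝓝 0) := tendsto_const_nhds.div_atTop tendsto_id
  refine squeeze_zero_norm' ?_ h1
  filter_upwards [eventually_gt_atTop 0] with s hs
  have h2 := log_le_logDeriv_Gamma_add_one hs
  have h3 := logDeriv_Gamma_le_log hs
  have h4 := logDeriv_Gamma_add_one hs
  have h5 : 1 / s = 2 * (1 / (2 * s)) := by field_simp
  rw [Real.norm_eq_abs, abs_le, digammaError]
  constructor <;> linarith

theorem digammaError_add_one_sub {s : ℝ} (hs : 0 < s) :
    0 ≤ digammaError (s + 1) - digammaError s ∧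
      digammaError (s + 1) - digammaError s ≤ 1 / 8 * (1 / s ^ 2 - 1 / (s + 1) ^ 2) := by
  have hs1 : 0 < s + 1 := by linarith
  have h1 : digammaError (s + 1) - digammaError s =
      1 / (2 * (s + 1)) + 1 / (2 * s) - Real.log ((s + 1) / s) := by
    rw [digammaError, digammaError, logDeriv_Gamma_add_one hs1, Real.log_div hs1.ne' hs.ne']
    field_simp
    ring
  rw [h1]
  constructor
  · have h2 := Real.self_le_sinh_iff.2 (Real.log_nonneg
      ((one_le_div hs).2 (by linarith : s ≤ s + 1)))
    rw [Real.sinh_log (by positivity)] at h2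
    have h3 : ((s + 1) / s - ((s + 1) / s)⁻¹) / 2 = 1 / (2 * (s + 1)) + 1 / (2 * s) := by
      field_simp
      ring
    linarith
  · have h2 := Real.le_log_one_add_of_nonneg (x := 1 / s) (by positivity)
    rw [show 1 + 1 / s = (s + 1) / s by field_simp] at h2
    have h3 : 1 / (2 * (s + 1)) + 1 / (2 * s) - 2 * (1 / s) / (1 / s + 2) =
        1 / (2 * s * (s + 1) * (2 * s + 1)) := by
      field_simp
      ring
    have h4 : 1 / (2 * s * (s + 1) * (2 * s + 1)) ≤ 1 / 8 * (1 / s ^ 2 - 1 / (s + 1) ^ 2) := by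
      have : 1 / 8 * (1 / s ^ 2 - 1 / (s + 1) ^ 2) - 1 / (2 * s * (s + 1) * (2 * s + 1)) =
          1 / (8 * s ^ 2 * (s + 1) ^ 2 * (2 * s + 1)) := by
        field_simp
        ring
      have h5 : 0 < 1 / (8 * s ^ 2 * (s + 1) ^ 2 * (2 * s + 1)) := by positivity
      linarith
    linarith

theorem abs_digammaError_le {s : ℝ} (hs : 0 < s) : |digammaError s| ≤ 1 / (8 * s ^ 2) := by
  have hn : ∀ n : ℕ, 0 < s + n := fun n => by positivity
  have hatTop : Tendsto (fun n : ℕ => s + n) atTop atTop :=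
    tendsto_atTop_add_const_left _ _ tendsto_natCast_atTop_atTop
  have h1 : Monotone fun n : ℕ => digammaError (s + n) := monotone_nat_of_le_succ fun n => by
    have := (digammaError_add_one_sub (hn n)).1
    push_cast
    rw [← add_assoc]
    linarith
  have h2 : Antitone fun n : ℕ => digammaError (s + n) + 1 / 8 * (1 / (s + n) ^ 2) :=
    antitone_nat_of_succ_le fun n => by
      have := (digammaError_add_one_sub (hn n)).2
      push_cast
      rw [← add_assoc]
      linarith
  have t1 := tendsto_digammaError.comp hatTop
  have t2 : Tendsto (fun n : ℕ => 1 / 8 * (1 / (s + n) ^ 2)) atTop (𝓝 0) := by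
    have := (tendsto_const_nhds (x := (1 : ℝ))).div_atTop
      ((tendsto_pow_atTop two_ne_zero).comp hatTop)
    have h5 := this.const_mul (1 / 8 : ℝ)
    rw [mul_zero] at h5
    exact h5
  have h3 := h1.ge_of_tendsto t1 0
  have h4 := h2.le_of_tendsto (by simpa using t1.add t2) 0
  simp only [Nat.cast_zero, add_zero] at h3 h4
  have h5 : 1 / (8 * s ^ 2) = 1 / 8 * (1 / s ^ 2) := by field_simp
  rw [abs_le, h5]
  constructor <;> linarith

/-- The Bessel series normalized to have constant term `1`. -/
noncomputable def normalizedBesselSeries (z ν : ℂ) : ℂ :=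
  Complex.Gamma (ν + 1) * besselSeries ν z

theorem norm_Gamma_div_Gamma_add_nat_le {ν : ℂ} (hν : 0 < ν.re) (k : ℕ) :
    ‖Complex.Gamma (ν + 1) * (Complex.Gamma (ν + (k + 1 : ℕ) + 1))⁻¹‖ ≤ 1 / ‖ν + 1‖ := by
  have hre : ∀ n : ℕ, 0 < (ν + n + 1).re := fun n => by
    simp only [Complex.add_re, Complex.natCast_re, Complex.one_re]
    positivity
  have hne : ∀ n : ℕ, ν + n + 1 ≠ 0 := fun n h => by
    have := hre n
    rw [h, Complex.zero_re] at this
    exact lt_irrefl _ this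
  have hG0 : Complex.Gamma (ν + 1) ≠ 0 := by
    have := Complex.Gamma_ne_zero_of_re_pos (hre 0)
    simpa using this
  induction k with
  | zero =>
    have h0 : ν + 1 ≠ 0 := by simpa using hne 0
    rw [zero_add, Nat.cast_one, Complex.Gamma_add_one _ h0, mul_inv, mul_left_comm,
      mul_inv_cancel₀ hG0, mul_one, norm_inv, one_div]
  | succ k ih =>
    have e : ν + ((k + 1 + 1 : ℕ) : ℂ) + 1 = (ν + (k + 1 : ℕ) + 1) + 1 := by
      push_cast
      ring
    have h1 : 1 ≤ ‖ν + (k + 1 : ℕ) + 1‖ := by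
      refine le_trans ?_ (Complex.re_le_norm _)
      simp only [Complex.add_re, Complex.natCast_re, Complex.one_re]
      have : (0 : ℝ) ≤ (k + 1 : ℕ) := Nat.cast_nonneg _
      linarith
    rw [e, Complex.Gamma_add_one _ (hne _), mul_inv, mul_left_comm, norm_mul, norm_inv]
    calc _ ≤ 1 * (1 / ‖ν + 1‖) := by
          gcongr
          exact inv_le_one_of_one_le₀ h1
      _ = _ := one_mul _

theorem norm_normalizedBesselSeries_sub_one_le (z : ℂ) {ν : ℂ} (hν : 0 < ν.re) :
    ‖normalizedBesselSeries z ν - 1‖ ≤ Real.exp ‖z‖ / ‖ν + 1‖ := by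
  have hG0 : Complex.Gamma (ν + 1) ≠ 0 := Complex.Gamma_ne_zero_of_re_pos (by simp; linarith)
  have h := (hasSum_nat_add_iff' 1).2 ((hasSum_besselSeries ν z).mul_left (Complex.Gamma (ν + 1)))
  simp only [Finset.range_one, Finset.sum_singleton, pow_zero, Nat.factorial_zero, Nat.cast_one,
    Nat.cast_zero, add_zero, div_one, one_mul, mul_inv_cancel₀ hG0] at h
  have hexp : HasSum (fun k : ℕ => ‖z‖ ^ k / k.factorial) (Real.exp ‖z‖) := by
    rw [Real.exp_eq_exp_ℝ]
    exact NormedSpace.expSeries_div_hasSum_exp ‖z‖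
  have hexp' := ((hasSum_nat_add_iff' 1).2 hexp).mul_right (1 / ‖ν + 1‖)
  have h2 := h.norm_le_of_bounded hexp' fun k => by
    rw [mul_left_comm, norm_mul, norm_div, norm_pow, norm_neg, Complex.norm_natCast]
    gcongr
    exact norm_Gamma_div_Gamma_add_nat_le hν k
  refine h2.trans ?_
  rw [← mul_one_div (Real.exp ‖z‖)]
  gcongr
  simp

theorem differentiableAt_normalizedBesselSeries (z : ℂ) {ν : ℂ} (hν : 0 < ν.re) :
    DifferentiableAt ℂ (normalizedBesselSeries z) ν := by
  have h1 : DifferentiableAt ℂ Complex.Gamma (ν + 1) :=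
    Complex.differentiableAt_Gamma _ fun m h => by
      have := congrArg Complex.re h
      simp only [Complex.add_re, Complex.one_re, Complex.neg_re, Complex.natCast_re] at this
      have : (0 : ℝ) ≤ m := m.cast_nonneg
      linarith
  exact (h1.hasDerivAt.comp_add_const ν 1).differentiableAt.mul (differentiable_besselSeries z ν)

theorem norm_deriv_normalizedBesselSeries_le (z : ℂ) {ν : ℝ} (hν : 0 < ν) :
    ‖deriv (normalizedBesselSeries z) ν‖ ≤ 4 * Real.exp ‖z‖ / ν ^ 2 := by
  have hre : ∀ w ∈ Metric.closedBall (ν : ℂ) (ν / 2), ν / 2 ≤ w.re := fun w hw => by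
    rw [mem_closedBall_iff_norm] at hw
    have := (abs_le.1 ((Complex.abs_re_le_norm _).trans hw)).1
    simp only [Complex.sub_re, Complex.ofReal_re] at this
    linarith
  have hd : DifferentiableOn ℂ (fun w => normalizedBesselSeries z w - 1)
      (Metric.closedBall (ν : ℂ) (ν / 2)) := fun w hw =>
    ((differentiableAt_normalizedBesselSeries z
      ((half_pos hν).trans_le (hre w hw))).sub_const 1).differentiableWithinAt
  have h := Complex.norm_deriv_le_of_forall_mem_sphere_norm_le (C := 2 * Real.exp ‖z‖ / ν)
    (half_pos hν) (hd.diffContOnCl_ball subset_rfl) fun w hw => ?_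
  · rw [deriv_sub_const] at h
    refine h.trans (le_of_eq ?_)
    field_simp
    norm_num
  · have hw' := hre w (Metric.sphere_subset_closedBall hw)
    refine (norm_normalizedBesselSeries_sub_one_le z ((half_pos hν).trans_le hw')).trans ?_
    have h1 : ν / 2 ≤ ‖w + 1‖ := by
      refine le_trans ?_ (Complex.re_le_norm _)
      simp only [Complex.add_re, Complex.one_re]
      linarith
    rw [show 2 * Real.exp ‖z‖ / ν = Real.exp ‖z‖ / (ν / 2) by field_simp]
    gcongr

/-- `besselJ` divided by its leading power `(x / 2) ^ ν / Γ(ν + 1)`. -/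
noncomputable def normalizedBesselJ (x ν : ℝ) : ℝ :=
  (normalizedBesselSeries (x ^ 2 / 4 : ℝ) ν).re

theorem normalizedBesselSeries_ofReal (x ν : ℝ) :
    normalizedBesselSeries (x ^ 2 / 4 : ℝ) ν = normalizedBesselJ x ν := by
  rw [normalizedBesselJ, normalizedBesselSeries, besselSeries_ofReal,
    show (ν : ℂ) + 1 = ((ν + 1 : ℝ) : ℂ) by push_cast; rfl, Complex.Gamma_ofReal,
    ← Complex.ofReal_mul, Complex.ofReal_re]

theorem besselJ_eq_mul_normalizedBesselJ (x : ℝ) {ν : ℝ} (hν : 0 < ν) :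
    besselJ ν x = (x / 2) ^ ν / Real.Gamma (ν + 1) * normalizedBesselJ x ν := by
  rw [besselJ_eq_re, normalizedBesselJ, normalizedBesselSeries,
    show (ν : ℂ) + 1 = ((ν + 1 : ℝ) : ℂ) by push_cast; rfl, Complex.Gamma_ofReal,
    Complex.re_ofReal_mul]
  field_simp

theorem abs_normalizedBesselJ_sub_one_le (x : ℝ) {ν : ℝ} (hν : 0 < ν) :
    |normalizedBesselJ x ν - 1| ≤ Real.exp (x ^ 2 / 4) / ν := by
  have h := norm_normalizedBesselSeries_sub_one_le ((x ^ 2 / 4 : ℝ) : ℂ) (ν := (ν : ℂ))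
    (by simpa using hν)
  have h1 : ‖(ν : ℂ) + 1‖ = ν + 1 := by
    rw [show (ν : ℂ) + 1 = ((ν + 1 : ℝ) : ℂ) by push_cast; rfl, Complex.norm_real,
      Real.norm_of_nonneg (by linarith)]
  rw [normalizedBesselSeries_ofReal, h1, Complex.norm_real, Real.norm_of_nonneg (by positivity),
    ← Complex.ofReal_one, ← Complex.ofReal_sub, Complex.norm_real, Real.norm_eq_abs] at h
  refine h.trans ?_
  gcongr
  linarith

theorem exists_hasDerivAt_normalizedBesselJ (x : ℝ) {ν : ℝ} (hν : 0 < ν) :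
    ∃ d, HasDerivAt (normalizedBesselJ x) d ν ∧ |d| ≤ 4 * Real.exp (x ^ 2 / 4) / ν ^ 2 := by
  have h := (differentiableAt_normalizedBesselSeries ((x ^ 2 / 4 : ℝ) : ℂ) (ν := (ν : ℂ))
    (by simpa using hν)).hasDerivAt.real_of_complex
  refine ⟨_, h, (Complex.abs_re_le_norm _).trans ?_⟩
  have h1 := norm_deriv_normalizedBesselSeries_le ((x ^ 2 / 4 : ℝ) : ℂ) hν
  rwa [Complex.norm_real, Real.norm_of_nonneg (by positivity)] at h1

theorem hasDerivAt_besselJ_order {x : ℝ} (hx : 0 < x) {ν d : ℝ} (hν : 0 < ν)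
    (hd : HasDerivAt (normalizedBesselJ x) d ν) :
    HasDerivAt (fun μ => besselJ μ x) ((x / 2) ^ ν / Real.Gamma (ν + 1) *
      ((Real.log (x / 2) - logDeriv Real.Gamma (ν + 1)) * normalizedBesselJ x ν + d)) ν := by
  have hG : Real.Gamma (ν + 1) ≠ 0 := (Real.Gamma_pos_of_pos (by linarith)).ne'
  have hΓ : DifferentiableAt ℝ Real.Gamma (ν + 1) := Real.differentiableAt_Gamma fun m => by
    have : (0 : ℝ) ≤ m := m.cast_nonneg
    linarith
  have h1 := (((hasDerivAt_id ν).const_rpow (half_pos hx)).div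
    (hΓ.hasDerivAt.comp_add_const ν 1) hG).mul hd
  refine (h1.congr_of_eventuallyEq ?_).congr_deriv ?_
  · filter_upwards [lt_mem_nhds hν] with μ hμ
    exact besselJ_eq_mul_normalizedBesselJ x hμ
  · simp only [id, logDeriv_apply, Pi.div_apply]
    field_simp

/-- `besselY` divided by its leading power `-Γ(ν) / π * (x / 2) ^ (-ν)`. -/
noncomputable def normalizedBesselY (x ν : ℝ) : ℝ :=
  -π * besselY ν x * (x / 2) ^ ν / Real.Gamma ν

theorem sub_one_mem_nonIntegers {ν : ℝ} (hν : ν ∈ nonIntegers) : ν - 1 ∈ nonIntegers := by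
  intro n hn
  refine hν (n + 1) ?_
  push_cast
  linarith

theorem normalized_wronskian {x : ℝ} (hx : 0 < x) {ν : ℝ} (hν0 : 0 < ν) (hν : ν ∈ nonIntegers) :
    normalizedBesselJ x ν * normalizedBesselY x (ν + 1) =
      1 + x ^ 2 / 4 / (ν * (ν + 1)) * normalizedBesselJ x (ν + 1) * normalizedBesselY x ν := by
  have hW := besselJ_mul_besselY_wronskian hν hx
  have hν1 : 0 < ν + 1 := by linarith
  rw [besselJ_eq_mul_normalizedBesselJ x hν0, besselJ_eq_mul_normalizedBesselJ x hν1,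
    Real.Gamma_add_one hν1.ne', Real.Gamma_add_one hν0.ne', Real.rpow_add_one (by positivity)] at hW
  rw [normalizedBesselY, normalizedBesselY, Real.Gamma_add_one hν0.ne',
    Real.rpow_add_one (by positivity)]
  have hW' := congrArg (fun r => -(π / 2) * r) hW
  simp only [neg_mul_neg] at hW'
  rw [show π / 2 * (2 / π) = 1 by field_simp] at hW'
  refine eq_add_of_sub_eq (Eq.trans ?_ hW')
  field_simp
  ring

theorem pi_mul_integral_eq {x : ℝ} (hx : 0 < x) {ν : ℝ} (hν0 : 0 < ν) (hν : ν ∈ nonIntegers)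
    {d e : ℝ} (hd : HasDerivAt (normalizedBesselJ x) d ν)
    (he : HasDerivAt (normalizedBesselJ x) e (ν + 1)) :
    π * ν * ∫ t in Ioi x, besselJ ν t * besselY ν t / t =
      normalizedBesselJ x ν * normalizedBesselY x ν / (2 * ν) +
        (Real.log (x / 2) - logDeriv Real.Gamma (ν + 1)) + normalizedBesselY x (ν + 1) * d -
        x ^ 2 / 4 / (ν * (ν + 1)) * normalizedBesselY x ν *
          (e - normalizedBesselJ x (ν + 1) / (ν + 1)) := by
  have hν1 : 0 < ν + 1 := by linarith
  have hF := two_mul_integral_besselJ_mul_besselY hν0.le hν hx (hasDerivAt_besselJ_order hx hν0 hd)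
    (hasDerivAt_besselJ_order hx hν1 he)
  have hW := normalized_wronskian hx hν0 hν
  have hY : besselY ν x = -(Real.Gamma ν / (π * (x / 2) ^ ν) * normalizedBesselY x ν) := by
    rw [normalizedBesselY]
    field_simp
  have hY1 : besselY (ν + 1) x =
      -(ν * Real.Gamma ν / (π * ((x / 2) ^ ν * (x / 2))) * normalizedBesselY x (ν + 1)) := by
    rw [normalizedBesselY, Real.Gamma_add_one hν0.ne', Real.rpow_add_one (by positivity)]
    field_simp
  rw [besselJ_eq_mul_normalizedBesselJ x hν0, hY, hY1, logDeriv_Gamma_add_one hν1,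
    Real.Gamma_add_one hν1.ne', Real.Gamma_add_one hν0.ne', Real.rpow_add_one (by positivity)] at hF
  have hF' : π * ν * ∫ t in Ioi x, besselJ ν t * besselY ν t / t =
      normalizedBesselJ x ν * normalizedBesselY x ν / (2 * ν) -
        x ^ 2 / 4 / (ν * (ν + 1)) * normalizedBesselY x ν *
          ((Real.log (x / 2) - (logDeriv Real.Gamma (ν + 1) + 1 / (ν + 1))) *
            normalizedBesselJ x (ν + 1) + e) +
        normalizedBesselY x (ν + 1) * ((Real.log (x / 2) - logDeriv Real.Gamma (ν + 1)) *
          normalizedBesselJ x ν + d) := by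
    calc _ = π / 2 * (2 * ν * ∫ t in Ioi x, besselJ ν t * besselY ν t / t) := by ring
      _ = _ := by
        rw [hF]
        field_simp
        ring
  rw [hF']
  linear_combination (Real.log (x / 2) - logDeriv Real.Gamma (ν + 1)) * hW

theorem tendsto_normalizedBesselY {x : ℝ} (hx : 0 < x) {ν : ℝ} (hν : 0 < ν) :
    Tendsto (normalizedBesselY x) (𝓝[nonIntegers] ν) (𝓝 (normalizedBesselY x ν)) := by
  have hΓ : DifferentiableAt ℝ Real.Gamma ν := Real.differentiableAt_Gamma fun m => by
    have : (0 : ℝ) ≤ m := m.cast_nonneg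
    linarith
  have h1 := (tendsto_besselY_order hν.le hx).const_mul (-π)
  have h2 : Tendsto (fun μ : ℝ => (x / 2) ^ μ) (𝓝[nonIntegers] ν) (𝓝 ((x / 2) ^ ν)) :=
    ((hasDerivAt_id ν).const_rpow (half_pos hx)).continuousAt.tendsto.mono_left nhdsWithin_le_nhds
  exact (h1.mul h2).div (hΓ.continuousAt.tendsto.mono_left nhdsWithin_le_nhds)
    (Real.Gamma_pos_of_pos hν).ne'

theorem exists_abs_normalizedBesselY_le_on_Icc {x : ℝ} (hx : 0 < x) {a b : ℝ} (ha : 0 < a) :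
    ∃ M, ∀ ν ∈ Icc a b, ν ∈ nonIntegers → |normalizedBesselY x ν| ≤ M := by
  refine (isCompact_Icc (a := a) (b := b)).induction_on
    (p := fun s => ∃ M, ∀ ν ∈ s, ν ∈ nonIntegers → |normalizedBesselY x ν| ≤ M)
    ⟨0, by simp⟩ ?_ ?_ ?_
  · rintro s t hst ⟨M, hM⟩
    exact ⟨M, fun ν hν => hM ν (hst hν)⟩
  · rintro s t ⟨M, hM⟩ ⟨M', hM'⟩
    refine ⟨max M M', fun ν hν hN => ?_⟩
    rcases hν with hν | hν
    · exact (hM ν hν hN).trans (le_max_left _ _)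
    · exact (hM' ν hν hN).trans (le_max_right _ _)
  · intro ν hν
    have h := (tendsto_normalizedBesselY hx (ha.trans_le hν.1)).abs.eventually_le_const
      (lt_add_one _)
    rw [eventually_nhdsWithin_iff] at h
    exact ⟨_, mem_nhdsWithin_of_mem_nhds h, _, fun μ hμ hN => hμ hN⟩

theorem exists_abs_normalizedBesselY_le {x : ℝ} (hx : 0 < x) :
    ∃ M, 0 < M ∧ ∀ ν, 6 * Real.exp (x ^ 2 / 4) + 1 ≤ ν → ν ∈ nonIntegers →
      |normalizedBesselY x ν| ≤ M := by
  set E := Real.exp (x ^ 2 / 4) with hE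
  have hE0 : 0 < E := Real.exp_pos _
  have hzE : x ^ 2 / 4 ≤ E := by
    have := Real.add_one_le_exp (x ^ 2 / 4)
    linarith
  obtain ⟨M₀, hM₀⟩ := exists_abs_normalizedBesselY_le_on_Icc hx (a := 6 * E + 1)
    (b := 6 * E + 1 + 1) (by positivity)
  set M := max M₀ 4 with hM
  have hM4 : 4 ≤ M := le_max_right _ _
  have hjb : ∀ ν, 6 * E + 1 ≤ ν → |normalizedBesselJ x ν - 1| ≤ 1 / 2 := fun ν hν => by
    have hν0 : 0 < ν := by linarith
    refine (abs_normalizedBesselJ_sub_one_le x hν0).trans ?_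
    rw [div_le_iff₀ hν0]
    linarith
  have key : ∀ n : ℕ, ∀ ν, 6 * E + 1 ≤ ν → ν ≤ 6 * E + 1 + 1 + n → ν ∈ nonIntegers →
      |normalizedBesselY x ν| ≤ M := by
    intro n
    induction n with
    | zero =>
      intro ν h1 h2 hN
      exact (hM₀ ν ⟨h1, by simpa using h2⟩ hN).trans (le_max_left _ _)
    | succ n ih =>
      intro ν h1 h2 hN
      rcases le_or_gt ν (6 * E + 1 + 1 + n) with h3 | h3
      · exact ih ν h1 h3 hN
      push_cast at h2
      have hn : (0 : ℝ) ≤ n := n.cast_nonneg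
      obtain ⟨μ, rfl⟩ : ∃ μ, ν = μ + 1 := ⟨ν - 1, by ring⟩
      have hμN : μ ∈ nonIntegers := by simpa using sub_one_mem_nonIntegers hN
      have hμ1 : 6 * E + 1 ≤ μ := by linarith
      have hμ0 : 0 < μ := by linarith
      have hy := ih μ hμ1 (by linarith) hμN
      have hW := normalized_wronskian hx hμ0 hμN
      have hj := abs_le.1 (hjb μ hμ1)
      have hj1 := abs_le.1 (hjb (μ + 1) h1)
      have hc : x ^ 2 / 4 / (μ * (μ + 1)) ≤ 1 / 6 := by
        rw [div_le_iff₀ (by positivity)]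
        nlinarith
      have hR : |x ^ 2 / 4 / (μ * (μ + 1)) * normalizedBesselJ x (μ + 1) * normalizedBesselY x μ| ≤
          1 / 6 * (3 / 2) * M := by
        rw [abs_mul, abs_mul, abs_of_nonneg (show 0 ≤ x ^ 2 / 4 / (μ * (μ + 1)) by positivity)]
        gcongr
        rw [abs_le]
        constructor <;> linarith
      have hL : 1 / 2 * |normalizedBesselY x (μ + 1)| ≤
          |normalizedBesselJ x μ * normalizedBesselY x (μ + 1)| := by
        rw [abs_mul]
        gcongr
        exact le_trans (by linarith) (le_abs_self _)
      rw [hW] at hL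
      have hA := abs_add_le (1 : ℝ)
        (x ^ 2 / 4 / (μ * (μ + 1)) * normalizedBesselJ x (μ + 1) * normalizedBesselY x μ)
      rw [abs_one] at hA
      linarith
  refine ⟨M, by linarith, fun ν h1 hN => ?_⟩
  obtain ⟨n, hn⟩ := exists_nat_ge ν
  exact key n ν h1 (by linarith) hN

theorem exists_abs_normalizedBesselY_sub_one_le {x : ℝ} (hx : 0 < x) :
    ∃ K, 0 < K ∧ ∀ ν, 6 * Real.exp (x ^ 2 / 4) + 2 ≤ ν → ν ∈ nonIntegers →
      |normalizedBesselY x ν - 1| ≤ K / ν := by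
  obtain ⟨M, hM0, hM⟩ := exists_abs_normalizedBesselY_le hx
  set E := Real.exp (x ^ 2 / 4) with hE
  have hE0 : 0 < E := Real.exp_pos _
  have hzE : x ^ 2 / 4 ≤ E := by
    have := Real.add_one_le_exp (x ^ 2 / 4)
    linarith
  refine ⟨4 * E + 6 * E * M, by positivity, fun ν h1 hN => ?_⟩
  obtain ⟨μ, rfl⟩ : ∃ μ, ν = μ + 1 := ⟨ν - 1, by ring⟩
  have hμN : μ ∈ nonIntegers := by simpa using sub_one_mem_nonIntegers hN
  have hμ1 : 6 * E + 1 ≤ μ := by linarith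
  have hμ0 : 0 < μ := by linarith
  have hW := normalized_wronskian hx hμ0 hμN
  have hj := abs_normalizedBesselJ_sub_one_le x hμ0
  have hj1 := abs_normalizedBesselJ_sub_one_le x (by linarith : 0 < μ + 1)
  have hb : E / μ ≤ 1 / 2 := by
    rw [div_le_iff₀ hμ0]
    linarith
  have hb1 : E / (μ + 1) ≤ 1 / 2 := by
    rw [div_le_iff₀ (by linarith)]
    linarith
  have hjl := (abs_le.1 (hj.trans hb))
  have hj1l := (abs_le.1 (hj1.trans hb1))
  have hR : |x ^ 2 / 4 / (μ * (μ + 1)) * normalizedBesselJ x (μ + 1) * normalizedBesselY x μ| ≤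
      E / μ * (3 / 2) * M := by
    rw [abs_mul, abs_mul, abs_of_nonneg (show 0 ≤ x ^ 2 / 4 / (μ * (μ + 1)) by positivity)]
    gcongr
    · nlinarith
    · rw [abs_le]
      constructor <;> linarith
    · exact hM μ hμ1 hμN
  have hL : 1 / 2 * |normalizedBesselY x (μ + 1) - 1| ≤
      |normalizedBesselJ x μ * (normalizedBesselY x (μ + 1) - 1)| := by
    rw [abs_mul]
    gcongr
    exact le_trans (by linarith) (le_abs_self _)
  rw [show normalizedBesselJ x μ * (normalizedBesselY x (μ + 1) - 1) =
    x ^ 2 / 4 / (μ * (μ + 1)) * normalizedBesselJ x (μ + 1) * normalizedBesselY x μ -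
      (normalizedBesselJ x μ - 1) by linear_combination hW] at hL
  have hA := abs_sub (x ^ 2 / 4 / (μ * (μ + 1)) * normalizedBesselJ x (μ + 1) *
    normalizedBesselY x μ) (normalizedBesselJ x μ - 1)
  have hfin : |normalizedBesselY x (μ + 1) - 1| ≤ (2 * E + 3 * E * M) / μ := by
    have : (2 * E + 3 * E * M) / μ = 2 * (E / μ * (3 / 2) * M + E / μ) := by
      field_simp
      ring
    linarith
  refine hfin.trans ?_
  rw [div_le_div_iff₀ hμ0 (by linarith)]
  nlinarith [mul_pos hE0 hM0]

theorem exists_abs_integral_sub_le_of_nonIntegers {x : ℝ} (hx : 0 < x) :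
    ∃ C ν₀ : ℝ, 0 < C ∧ 0 < ν₀ ∧ ∀ ν : ℝ, ν₀ ≤ ν → ν ∈ nonIntegers →
      |(∫ t in Ioi x, besselJ ν t * besselY ν t / t)
          - 1 / (ν * π) * Real.log (x / (2 * ν))| ≤ C / ν ^ 3 := by
  obtain ⟨M, hM0, hM⟩ := exists_abs_normalizedBesselY_le hx
  obtain ⟨K, hK0, hK⟩ := exists_abs_normalizedBesselY_sub_one_le hx
  set E := Real.exp (x ^ 2 / 4) with hE
  have hE0 : 0 < E := Real.exp_pos _
  have hzE : x ^ 2 / 4 ≤ E := by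
    have := Real.add_one_le_exp (x ^ 2 / 4)
    linarith
  refine ⟨3 / 4 * K + E / 2 + 1 + 4 * E * M + E * M * (4 * E + 3 / 2), 6 * E + 2, by positivity,
    by positivity, fun ν hν hN => ?_⟩
  have hν0 : 0 < ν := by linarith
  obtain ⟨d, hd, hdb⟩ := exists_hasDerivAt_normalizedBesselJ x hν0
  obtain ⟨e, he, heb⟩ := exists_hasDerivAt_normalizedBesselJ x (by linarith : 0 < ν + 1)
  have hF := pi_mul_integral_eq hx hν0 hN hd he
  set F := ∫ t in Ioi x, besselJ ν t * besselY ν t / t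
  set j := normalizedBesselJ x ν
  set j' := normalizedBesselJ x (ν + 1)
  set y := normalizedBesselY x ν
  set y' := normalizedBesselY x (ν + 1)
  have hy : |y| ≤ M := hM ν (by linarith) hN
  have hy' : |y'| ≤ M := hM (ν + 1) (by linarith) (add_one_mem_nonIntegers hN)
  have hy1 : |y - 1| ≤ K / ν := hK ν hν hN
  have hj1 : |j - 1| ≤ E / ν := abs_normalizedBesselJ_sub_one_le x hν0
  have hj1' : |j' - 1| ≤ E / (ν + 1) := abs_normalizedBesselJ_sub_one_le x (by linarith)
  have hj : |j| ≤ 3 / 2 := by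
    have : E / ν ≤ 1 / 2 := by
      rw [div_le_iff₀ hν0]
      linarith
    have := abs_le.1 (hj1.trans this)
    rw [abs_le]
    constructor <;> linarith
  have hj' : |j'| ≤ 3 / 2 := by
    have : E / (ν + 1) ≤ 1 / 2 := by
      rw [div_le_iff₀ (by linarith)]
      linarith
    have := abs_le.1 (hj1'.trans this)
    rw [abs_le]
    constructor <;> linarith
  have hT1 : |(j * y - 1) / (2 * ν)| ≤ (3 / 4 * K + E / 2) / ν ^ 2 := by
    have h1 : |j * y - 1| ≤ 3 / 2 * (K / ν) + E / ν := by
      rw [show j * y - 1 = j * (y - 1) + (j - 1) by ring]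
      refine (abs_add_le _ _).trans ?_
      rw [abs_mul]
      gcongr
    rw [abs_div, abs_of_pos (by positivity : 0 < 2 * ν), div_le_iff₀ (by positivity)]
    refine h1.trans (le_of_eq ?_)
    field_simp
    ring
  have hT2 : |digammaError ν| ≤ 1 / ν ^ 2 := by
    refine (abs_digammaError_le hν0).trans ?_
    gcongr
    nlinarith [sq_nonneg ν]
  have hT3 : |y' * d| ≤ 4 * E * M / ν ^ 2 := by
    rw [abs_mul]
    calc |y'| * |d| ≤ M * (4 * E / ν ^ 2) := by gcongr
      _ = _ := by ring
  have hT4 : |x ^ 2 / 4 / (ν * (ν + 1)) * y * (e - j' / (ν + 1))| ≤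
      E * M * (4 * E + 3 / 2) / ν ^ 2 := by
    have h1 : |e - j' / (ν + 1)| ≤ 4 * E + 3 / 2 := by
      refine (abs_sub _ _).trans ?_
      have h2 : |e| ≤ 4 * E := heb.trans (div_le_self (by positivity) (by nlinarith))
      have h3 : |j' / (ν + 1)| ≤ 3 / 2 := by
        rw [abs_div, abs_of_pos (by linarith : 0 < ν + 1)]
        exact (div_le_self (abs_nonneg _) (by linarith)).trans hj'
      linarith
    rw [abs_mul, abs_mul, abs_of_nonneg (show 0 ≤ x ^ 2 / 4 / (ν * (ν + 1)) by positivity)]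
    calc _ ≤ E / ν ^ 2 * M * (4 * E + 3 / 2) := by
          gcongr
          nlinarith
      _ = _ := by ring
  have herr : F - 1 / (ν * π) * Real.log (x / (2 * ν)) = ((j * y - 1) / (2 * ν) - digammaError ν +
      y' * d - x ^ 2 / 4 / (ν * (ν + 1)) * y * (e - j' / (ν + 1))) / (π * ν) := by
    have hF2 : F = (π * ν * F) / (π * ν) := by field_simp
    rw [hF2, hF, digammaError, show x / (2 * ν) = x / 2 / ν by field_simp,
      Real.log_div (by positivity) hν0.ne']
    field_simp
    ring
  have hsum : |(j * y - 1) / (2 * ν) - digammaError ν +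
      y' * d - x ^ 2 / 4 / (ν * (ν + 1)) * y * (e - j' / (ν + 1))| ≤
      (3 / 4 * K + E / 2 + 1 + 4 * E * M + E * M * (4 * E + 3 / 2)) / ν ^ 2 := by
    refine (abs_sub _ _).trans ((add_le_add ((abs_add_le _ _).trans (add_le_add
      ((abs_sub _ _).trans (add_le_add hT1 hT2)) hT3)) hT4).trans (le_of_eq ?_))
    ring
  rw [herr, abs_div, abs_of_pos (by positivity : 0 < π * ν), div_le_iff₀ (by positivity)]
  refine hsum.trans ?_
  generalize hCdef : 3 / 4 * K + E / 2 + 1 + 4 * E * M + E * M * (4 * E + 3 / 2) = C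
  have hC : 0 < C := by
    rw [← hCdef]
    positivity
  rw [show C / ν ^ 3 * (π * ν) = π * (C / ν ^ 2) by field_simp]
  have hpi : 1 ≤ π := by linarith [Real.pi_gt_three]
  exact le_mul_of_one_le_left (by positivity) hpi

theorem stmt8 (x : ℝ) (hx : 0 < x) :
    ∃ C ν₀ : ℝ, 0 < C ∧ 0 < ν₀ ∧ ∀ ν : ℝ, ν₀ ≤ ν →
      |(∫ t in Set.Ioi x, besselJ ν t * besselY ν t / t)
          - 1 / (ν * Real.pi) * Real.log (x / (2 * ν))| ≤ C / ν ^ 3 := by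
  obtain ⟨C, ν₀, hC, hν₀, h⟩ := exists_abs_integral_sub_le_of_nonIntegers hx
  refine ⟨C, ν₀ + 1, hC, by linarith, fun ν hν => ?_⟩
  have hν0 : 0 < ν := by linarith
  have hid : Tendsto id (𝓝[nonIntegers] ν) (𝓝 ν) := tendsto_id.mono_left nhdsWithin_le_nhds
  have h1 := tendsto_integral_besselJ_mul_besselY_div hν0.le hid tendsto_id hx
  have h2 : ContinuousAt (fun μ : ℝ => 1 / (μ * π) * Real.log (x / (2 * μ))) ν := by
    have h3 : ContinuousAt (fun μ : ℝ => x / (2 * μ)) ν :=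
      continuousAt_const.div (by fun_prop) (by positivity)
    refine (continuousAt_const.div (by fun_prop) (by positivity)).mul (h3.log ?_)
    positivity
  have h4 : ContinuousAt (fun μ : ℝ => C / μ ^ 3) ν :=
    continuousAt_const.div (by fun_prop) (by positivity)
  refine le_of_tendsto_of_tendsto ((h1.sub (h2.tendsto.mono_left nhdsWithin_le_nhds)).abs)
    (h4.tendsto.mono_left nhdsWithin_le_nhds) ?_
  filter_upwards [self_mem_nhdsWithin,
    mem_nhdsWithin_of_mem_nhds (lt_mem_nhds (by linarith : ν₀ < ν))] with μ hμ hμν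
  exact h μ (le_of_lt hμν) hμ
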